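/- Let d ≥ 3 be odd, ℓ a positive integer and ε > 0. There exists a constant C = C(ε,ℓ,d) > 0 such that for every squarefree integer a > 1 with x^d − a irreducible over ℚ, the pure field K = ℚ(a^{1/d}) of degree d satisfies #Cl_K[ℓ] ≤ C · D_K^{1/2 − 1/(2(d−1)ℓ) − 1/(2d(d−1)ℓ) + ε}. -/

import Mathlib

open NumberField Polynomial

/-- The denominator ideal of `α ∈ K`: the set of `x ∈ 𝓞 K` with `x·α ∈ 𝓞 K`.
Its absolute norm is the non-archimedean part `∏_v max(1,|α|_v)^{d_v}` of the height. -/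
noncomputable def denIdeal (K : Type*) [Field K] [NumberField K] (α : K) : Ideal (𝓞 K) where
  carrier := {x : 𝓞 K | ∃ y : 𝓞 K, (x : K) * α = (y : K)}
  zero_mem' := ⟨0, by simp⟩
  add_mem' := by
    rintro a b ⟨ya, ha⟩ ⟨yb, hb⟩
    exact ⟨ya + yb, by push_cast; rw [add_mul, ha, hb]⟩
  smul_mem' := by
    rintro c x ⟨y, hy⟩
    exact ⟨c * y, by rw [smul_eq_mul]; push_cast; rw [mul_assoc, hy]⟩

/-- The relative multiplicative Weil height `H_K(α) = ∏_{v ∈ M_K} max(1,|α|_v)^{d_v}`. -/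
noncomputable def heightK (K : Type*) [Field K] [NumberField K] (α : K) : ℝ :=
  (Ideal.absNorm (denIdeal K α) : ℝ) * ∏ w : InfinitePlace K, max 1 (w α) ^ w.mult

/-- `N'_K(X)`: the number of `α ∈ K` with `ℚ(α) = K` and `H_K(α) < X`. -/
noncomputable def NprimeK (K : Type*) [Field K] [NumberField K] (X : ℝ) : ℕ :=
  Nat.card {α : K // IntermediateField.adjoin ℚ {α} = ⊤ ∧ heightK K α < X}

/-- `M_{K,ℓ} = inf_{X > 0} X^{-1/ℓ}(1 + N'_K(X))`. -/
noncomputable def MKl (K : Type*) [Field K] [NumberField K] (ℓ : ℕ) : ℝ :=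
  ⨅ X : {X : ℝ // 0 < X}, (X : ℝ) ^ (-(1:ℝ)/ℓ) * (1 + (NprimeK K X : ℝ))

/-- `η(K)`: the minimal height of a primitive element of `K`. -/
noncomputable def etaK (K : Type*) [Field K] [NumberField K] : ℝ :=
  sInf {x : ℝ | ∃ α : K, IntermediateField.adjoin ℚ {α} = ⊤ ∧ heightK K α = x}

/-- `D_K`: the absolute value of the discriminant. -/
noncomputable def DK (K : Type*) [Field K] [NumberField K] : ℕ :=
  (NumberField.discr K).natAbs

open ArithmeticFunction.vonMangoldt in
theorem exists_bound_tsum_residueClass {q : ℕ} [NeZero q] {a : ZMod q} (ha : IsUnit a) :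
    ∃ B : ℝ, ∀ x : ℝ, x ∈ Set.Ioc 1 2 →
      |∑' n, residueClass a n / (n : ℝ) ^ x - (q.totient : ℝ)⁻¹ / (x - 1)| ≤ B := by
  have H {x : ℝ} (hx : 1 < x) :
      ∑' n, residueClass a n / (n : ℝ) ^ x =
        (LFunctionResidueClassAux a x).re + (q.totient : ℝ)⁻¹ / (x - 1) := by
    refine Complex.ofReal_injective ?_
    simp only [Complex.ofReal_tsum, Complex.ofReal_div, Complex.ofReal_cpow (Nat.cast_nonneg _),
      Complex.ofReal_natCast,
      Complex.ofReal_add, Complex.ofReal_inv, Complex.ofReal_sub, Complex.ofReal_one]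
    simp_rw [← LFunctionResidueClassAux_real ha hx,
      eqOn_LFunctionResidueClassAux ha <| Set.mem_ofPred.mpr (Complex.ofReal_re x ▸ hx),
      sub_add_cancel, LSeries, LSeries.term]
    refine tsum_congr fun n ↦ ?_
    split_ifs with hn
    · simp only [hn, residueClass_apply_zero, Complex.ofReal_zero, zero_div]
    · rfl
  have hc : ContinuousOn (fun x : ℝ ↦ (LFunctionResidueClassAux a x).re) (Set.Icc 1 2) :=
    Complex.continuous_re.continuousOn.comp (t := Set.univ)
      (continuousOn_LFunctionResidueClassAux a) (fun ⦃x⦄ a ↦ trivial) |>.comp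
      Complex.continuous_ofReal.continuousOn fun x hx ↦ by
        simpa only [Set.mem_ofPred_eq, Complex.ofReal_re] using hx.1
  obtain ⟨B, hB⟩ := isCompact_Icc.exists_bound_of_continuousOn hc
  refine ⟨B, fun x hx ↦ ?_⟩
  rw [H hx.1, add_sub_cancel_right]
  exact hB x (Set.Ioc_subset_Icc_self hx)

open ArithmeticFunction.vonMangoldt in
theorem summable_residueClass_div_rpow {q : ℕ} (a : ZMod q) {x : ℝ} (hx : 1 < x) :
    Summable fun n : ℕ ↦ residueClass a n / (n : ℝ) ^ x := by
  have h := LSeriesSummable_of_abscissaOfAbsConv_lt_re (s := (x : ℂ)) <|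
      (abscissaOfAbsConv_residueClass_le_one a).trans_lt <| by simpa using mod_cast hx
  have h2 := h.norm
  refine h2.congr fun n ↦ ?_
  rcases eq_or_ne n 0 with rfl | hn
  · simp
  · rw [LSeries.term_of_ne_zero hn, norm_div, Complex.norm_natCast_cpow_of_pos (by omega)]
    simp [abs_of_nonneg (residueClass_nonneg a n)]

open ArithmeticFunction.vonMangoldt Filter Topology in
theorem tsum_residueClass_mul_polynomial {q : ℕ} [NeZero q] {a : ZMod q} (ha : IsUnit a)
    (h : ℝ[X]) :
    (∀ δ : ℝ, 0 < δ → Summable fun n : ℕ ↦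
      residueClass a n / n * ((n : ℝ) ^ (-δ) * h.eval ((n : ℝ) ^ (-δ)))) ∧
    ∃ B : ℝ, ∀ᶠ δ in 𝓝[>] (0 : ℝ),
      |∑' n : ℕ, residueClass a n / n * ((n : ℝ) ^ (-δ) * h.eval ((n : ℝ) ^ (-δ)))
        - (q.totient : ℝ)⁻¹ / δ * ∫ u in (0 : ℝ)..1, h.eval u| ≤ B := by
  induction h using Polynomial.induction_on' with
  | add f g hf hg =>
    obtain ⟨hfs, Bf, hBf⟩ := hf
    obtain ⟨hgs, Bg, hBg⟩ := hg
    constructor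
    · intro δ hδ
      refine ((hfs δ hδ).add (hgs δ hδ)).congr fun n ↦ ?_
      rw [eval_add]; ring
    · refine ⟨Bf + Bg, ?_⟩
      filter_upwards [hBf, hBg, self_mem_nhdsWithin] with δ h1 h2 hδ
      have e1 : ∑' n : ℕ, residueClass a n / n *
          ((n : ℝ) ^ (-δ) * (f + g).eval ((n : ℝ) ^ (-δ))) =
          ∑' n : ℕ, residueClass a n / n * ((n : ℝ) ^ (-δ) * f.eval ((n : ℝ) ^ (-δ))) +
          ∑' n : ℕ, residueClass a n / n * ((n : ℝ) ^ (-δ) * g.eval ((n : ℝ) ^ (-δ))) := by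
        rw [← (hfs δ hδ).tsum_add (hgs δ hδ)]
        refine tsum_congr fun n ↦ ?_
        rw [eval_add]; ring
      have e2 : ∫ u in (0 : ℝ)..1, (f + g).eval u =
          (∫ u in (0 : ℝ)..1, f.eval u) + ∫ u in (0 : ℝ)..1, g.eval u := by
        simp_rw [eval_add]
        exact intervalIntegral.integral_add (f.continuous.intervalIntegrable _ _)
          (g.continuous.intervalIntegrable _ _)
      rw [e1, e2]
      refine le_trans (le_of_eq ?_) ((abs_add_le _ _).trans (add_le_add h1 h2))
      congr 1; ring
  | monomial k c =>
    have key (δ : ℝ) (n : ℕ) : residueClass a n / n *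
        ((n : ℝ) ^ (-δ) * (monomial k c).eval ((n : ℝ) ^ (-δ))) =
        c * (residueClass a n / (n : ℝ) ^ (1 + (k + 1) * δ)) := by
      rcases eq_or_ne n 0 with rfl | hn
      · simp
      have hn' : (0 : ℝ) < n := by positivity
      have e : (n : ℝ) ^ (1 + (k + 1) * δ) * ((n : ℝ) ^ (-δ) * (n : ℝ) ^ (-δ * k)) = n := by
        rw [← Real.rpow_add hn', ← Real.rpow_add hn',
          show 1 + (k + 1) * δ + (-δ + -δ * k) = 1 by ring, Real.rpow_one]
      have e1 : (n : ℝ) ^ (1 + (k + 1) * δ) ≠ 0 := (Real.rpow_pos_of_pos hn' _).ne'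
      rw [eval_monomial, ← Real.rpow_natCast, ← Real.rpow_mul hn'.le, div_mul_eq_mul_div,
        mul_div_assoc', div_eq_div_iff hn'.ne' e1]
      linear_combination residueClass a n * c * e
    constructor
    · intro δ hδ
      simp_rw [key]
      exact (summable_residueClass_div_rpow a (by nlinarith [(k.cast_nonneg : (0:ℝ) ≤ k)])).mul_left c
    · obtain ⟨B, hB⟩ := exists_bound_tsum_residueClass ha
      refine ⟨|c| * B, ?_⟩
      have hk : (0 : ℝ) < k + 1 := by positivity
      have : ∀ᶠ δ in 𝓝[>] (0 : ℝ), δ < 1 / ((k : ℝ) + 1) :=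
        eventually_nhdsWithin_of_eventually_nhds (eventually_lt_nhds (by positivity))
      filter_upwards [this, self_mem_nhdsWithin] with δ h1 hδ
      have hδ : 0 < δ := hδ
      simp_rw [key, tsum_mul_left]
      have e2 : ∫ u in (0 : ℝ)..1, (monomial k c).eval u = c / (k + 1) := by
        simp_rw [eval_monomial]
        rw [intervalIntegral.integral_const_mul, integral_pow]
        simp; field_simp
      have := hB (1 + (k + 1) * δ) ⟨by nlinarith, by
        rw [lt_div_iff₀ hk] at h1; linarith⟩
      rw [e2]
      refine le_trans (le_of_eq ?_) (mul_le_mul_of_nonneg_left this (abs_nonneg c))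
      rw [← abs_mul]
      congr 1
      rw [mul_sub]
      congr 1
      field_simp
      ring

theorem exists_polynomial_le_zero_off_Icc {u v : ℝ} (hu : 0 < u) (huv : u < v) (hv : v < 1) :
    ∃ h : ℝ[X], (∀ x ∈ Set.Icc (0 : ℝ) 1, x ∉ Set.Icc u v → h.eval x ≤ 0) ∧
      0 < ∫ x in (0 : ℝ)..1, h.eval x := by
  set b : ℝ → ℝ := fun x ↦ max 0 ((x - u) * (v - x)) with hb
  have hbc : Continuous b := by fun_prop
  set A := ∫ x in (0 : ℝ)..1, b x with hA
  have hApos : 0 < A := by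
    refine intervalIntegral.integral_pos one_pos hbc.continuousOn (fun x _ ↦ le_max_left _ _)
      ⟨(u + v) / 2, ⟨by linarith, by linarith⟩, ?_⟩
    refine lt_of_lt_of_le ?_ (le_max_right _ _)
    nlinarith
  obtain ⟨h, hh⟩ := exists_polynomial_near_of_continuousOn 0 1 (fun x ↦ b x - A / 4)
    (by fun_prop) (A / 4) (by positivity)
  refine ⟨h, fun x hx hxn ↦ ?_, ?_⟩
  · have h1 := (abs_lt.mp (hh x hx)).2
    have : b x = 0 := by
      refine max_eq_left ?_
      simp only [Set.mem_Icc, not_and_or, not_le] at hxn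
      rcases hxn with h | h <;> nlinarith
    linarith
  · have h1 : ∫ x in (0 : ℝ)..1, (b x - A / 2) ≤ ∫ x in (0 : ℝ)..1, h.eval x := by
      refine intervalIntegral.integral_mono_on zero_le_one
        (Continuous.intervalIntegrable (by fun_prop) _ _) (h.continuous.intervalIntegrable _ _) ?_
      intro x hx
      have := (abs_lt.mp (hh x hx)).1
      linarith
    rw [intervalIntegral.integral_sub (hbc.intervalIntegrable _ _) (by simp)] at h1
    simp at h1
    linarith

open ArithmeticFunction ArithmeticFunction.vonMangoldt Filter Topology in
/-- The number of primes up to `X` in an invertible residue class is `≫ X ^ (1 - ε)`. -/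
theorem exists_mul_rpow_le_card_primes {q : ℕ} [NeZero q] {a : ZMod q} (ha : IsUnit a)
    {ε : ℝ} (hε : 0 < ε) (hε1 : ε < 1) :
    ∃ c : ℝ, 0 < c ∧ ∀ᶠ X : ℝ in atTop, c * X ^ (1 - ε) ≤
      ((Finset.Icc 1 ⌊X⌋₊).filter fun p : ℕ ↦ p.Prime ∧ (p : ZMod q) = a).card := by
  obtain ⟨h, h0, hinteg⟩ := exists_polynomial_le_zero_off_Icc (u := Real.exp (-1))
    (v := Real.exp (-(1 - ε))) (Real.exp_pos _) (Real.exp_lt_exp.mpr (by linarith))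
    (by rw [Real.exp_lt_one_iff]; linarith)
  obtain ⟨hs, B, hB⟩ := tsum_residueClass_mul_polynomial ha h
  obtain ⟨H, hH⟩ := isCompact_Icc.exists_bound_of_continuousOn
    (h.continuous.continuousOn (s := Set.Icc (0 : ℝ) 1))
  have hH0 : 0 ≤ H := (norm_nonneg _).trans (hH 0 (by simp))
  set I := ∫ x in (0 : ℝ)..1, h.eval x
  set R := ∑' n : ℕ, (if n.Prime then 0 else residueClass a n) / n with hR
  have hRs := summable_residueClass_non_primes_div a
  have hφ : (0 : ℝ) < (q.totient : ℝ)⁻¹ := by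
    have := Nat.totient_pos.mpr (NeZero.pos q); positivity
  have hlog : Tendsto (fun X : ℝ ↦ (Real.log X)⁻¹) atTop (𝓝[>] 0) :=
    tendsto_inv_atTop_nhdsGT_zero.comp Real.tendsto_log_atTop
  have hbig : ∀ᶠ X : ℝ in atTop, 2 * (B + H * R) / ((q.totient : ℝ)⁻¹ * I) ≤ Real.log X :=
    Real.tendsto_log_atTop.eventually_ge_atTop _
  refine ⟨(q.totient : ℝ)⁻¹ * I / (2 * (H + 1)), by positivity, ?_⟩
  filter_upwards [hlog.eventually hB, hbig, eventually_gt_atTop 1] with X h1 h2 h3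
  set S := (Finset.Icc 1 ⌊X⌋₊).filter fun p : ℕ ↦ p.Prime ∧ (p : ZMod q) = a with hS
  have hX0 : 0 < X := by linarith
  have hL : 0 < Real.log X := Real.log_pos h3
  set δ := (Real.log X)⁻¹ with hδ
  have hδ0 : 0 < δ := inv_pos.mpr hL
  have hterm (n : ℕ) : residueClass a n / n * ((n : ℝ) ^ (-δ) * h.eval ((n : ℝ) ^ (-δ))) ≤
      H * ((if n.Prime then 0 else residueClass a n) / n) +
      H * (if n ∈ S then Real.log X / X ^ (1 - ε) else 0) := by
    have hr : 0 ≤ residueClass a n / n := by positivity [residueClass_nonneg a n]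
    have hrn : 0 ≤ (if n.Prime then 0 else residueClass a n) / n := by
      split_ifs
      · simp
      · exact hr
    rcases Nat.eq_zero_or_pos n with rfl | hn
    · simp only [CharP.cast_eq_zero, div_zero, zero_mul, mul_zero, zero_add]
      positivity
    have hn' : (1 : ℝ) ≤ n := by exact_mod_cast hn
    have hu0 : 0 ≤ (n : ℝ) ^ (-δ) := by positivity
    have hu1 : (n : ℝ) ^ (-δ) ≤ 1 := Real.rpow_le_one_of_one_le_of_nonpos hn' (by linarith)
    have hexp : (n : ℝ) ^ (-δ) = Real.exp (-(Real.log n / Real.log X)) := by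
      rw [Real.rpow_def_of_pos (by linarith), hδ]; congr 1; ring
    by_cases hmem : (n : ℝ) ^ (-δ) ∈ Set.Icc (Real.exp (-1)) (Real.exp (-(1 - ε)))
    · have hle : residueClass a n / n * ((n : ℝ) ^ (-δ) * h.eval ((n : ℝ) ^ (-δ))) ≤
          H * (residueClass a n / n) := by
        rw [mul_comm H]
        refine mul_le_mul_of_nonneg_left ?_ hr
        have := (abs_le.mp (hH _ ⟨hu0, hu1⟩)).2
        nlinarith
      refine hle.trans ?_
      rw [← mul_add]
      refine mul_le_mul_of_nonneg_left ?_ hH0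
      by_cases hp : n.Prime
      · rw [if_pos hp, zero_div, zero_add]
        rw [hexp, Set.mem_Icc, Real.exp_le_exp, Real.exp_le_exp, neg_le_neg_iff, neg_le_neg_iff,
          div_le_one hL, le_div_iff₀ hL] at hmem
        have hnX : (n : ℝ) ≤ X := (Real.log_le_log_iff (by linarith) hX0).mp hmem.1
        have hXn : X ^ (1 - ε) ≤ n := by
          rw [← Real.log_le_log_iff (by positivity) (by linarith), Real.log_rpow hX0]
          exact hmem.2
        by_cases ha' : (n : ZMod q) = a
        · have : n ∈ S := by
            simp only [hS, Finset.mem_filter, Finset.mem_Icc]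
            exact ⟨⟨hn, Nat.le_floor hnX⟩, hp, ha'⟩
          rw [if_pos this]
          have : residueClass a n = Real.log n := by
            rw [residueClass, Set.indicator_of_mem (by exact ha'), vonMangoldt_apply_prime hp]
          rw [this]
          exact div_le_div₀ hL.le hmem.1 (by positivity) hXn
        · have : residueClass a n = 0 := by
            rw [residueClass, Set.indicator_of_notMem (by exact ha')]
          rw [this, zero_div]
          split_ifs <;> positivity
      · rw [if_neg hp]
        have : 0 ≤ (if n ∈ S then Real.log X / X ^ (1 - ε) else 0) := by
          split_ifs <;> positivity
        linarith
    · have := h0 _ ⟨hu0, hu1⟩ hmem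
      have h4 : residueClass a n / n * ((n : ℝ) ^ (-δ) * h.eval ((n : ℝ) ^ (-δ))) ≤ 0 :=
        mul_nonpos_of_nonneg_of_nonpos hr (mul_nonpos_of_nonneg_of_nonpos hu0 this)
      refine h4.trans (add_nonneg (mul_nonneg hH0 hrn) (mul_nonneg hH0 ?_))
      split_ifs <;> positivity
  have hsum2 : Summable fun n : ℕ ↦ (if n ∈ S then Real.log X / X ^ (1 - ε) else 0) :=
    summable_of_ne_finset_zero (s := S) fun n hn ↦ if_neg hn
  have htot := (hs δ hδ0).tsum_le_tsum hterm ((hRs.mul_left H).add (hsum2.mul_left H))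
  rw [(hRs.mul_left H).tsum_add (hsum2.mul_left H), tsum_mul_left, tsum_mul_left, ← hR,
    tsum_eq_sum (s := S) fun n hn ↦ if_neg hn, Finset.sum_congr rfl (fun n hn ↦ if_pos hn),
    Finset.sum_const, nsmul_eq_mul] at htot
  have h5 := (abs_le.mp h1).1
  rw [hδ, div_inv_eq_mul] at h5
  rw [div_le_iff₀ (by positivity)] at h2
  have hXe : (0 : ℝ) < X ^ (1 - ε) := by positivity
  have h6 : (q.totient : ℝ)⁻¹ * I / 2 * Real.log X ≤ H * (S.card * (Real.log X / X ^ (1 - ε))) := by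
    nlinarith
  have h7 : (q.totient : ℝ)⁻¹ * I / 2 * X ^ (1 - ε) ≤ H * S.card := by
    rw [← mul_le_mul_iff_left₀ hL]
    calc _ = (q.totient : ℝ)⁻¹ * I / 2 * Real.log X * X ^ (1 - ε) := by ring
      _ ≤ H * (S.card * (Real.log X / X ^ (1 - ε))) * X ^ (1 - ε) := by gcongr
      _ = _ := by field_simp
  rw [div_mul_eq_mul_div, div_le_iff₀ (by positivity)]
  have : (0 : ℝ) ≤ S.card := by positivity
  nlinarith

section IdealCount
variable {K : Type*} [Field K] [NumberField K]

open Ideal in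
theorem card_primes_absNorm_under_le (F : Finset (Ideal (𝓞 K))) (p : ℕ)
    (hF : ∀ P ∈ F, P.IsPrime ∧ P ≠ ⊥ ∧ absNorm (under ℤ P) = p) :
    F.card ≤ Module.finrank ℚ K := by
  classical
  rcases F.eq_empty_or_nonempty with rfl | ⟨P₀, hP₀⟩
  · simp
  obtain ⟨h1, h2, h3⟩ := hF P₀ hP₀
  have : NeZero P₀ := ⟨h2⟩
  have hp : p.Prime := h3 ▸ Nat.absNorm_under_prime P₀
  have hp0 : (span {(p : ℤ)} : Ideal ℤ) ≠ ⊥ := by simpa using hp.ne_zero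
  have hmax : (span {(p : ℤ)} : Ideal ℤ).IsMaximal :=
    PrincipalIdealRing.isMaximal_of_irreducible (Nat.prime_iff_prime_int.mp hp).irreducible
  have hpr := hmax.isPrime
  have : Fintype ((span {(p : ℤ)}).primesOver (𝓞 K)) :=
    (IsDedekindDomain.primesOver_finite _ _).fintype
  have hsum := Ideal.sum_ramification_inertia_eq_finrank (span {(p : ℤ)}) (𝓞 K)
  rw [← RingOfIntegers.rank K, ← hsum]
  have hmem (P : F) : (P : Ideal (𝓞 K)) ∈ (span {(p : ℤ)}).primesOver (𝓞 K) := by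
    obtain ⟨h1, h2, h3⟩ := hF P P.2
    refine ⟨h1, ?_⟩
    rw [← h3]
    exact Int.liesOver_span_absNorm _
  calc F.card = Fintype.card F := by simp
    _ ≤ Fintype.card ((span {(p : ℤ)}).primesOver (𝓞 K)) :=
      Fintype.card_le_of_injective (fun P ↦ ⟨P, hmem P⟩) fun P Q h ↦ Subtype.ext (by simpa using h)
    _ = ∑ q : (span {(p : ℤ)}).primesOver (𝓞 K), 1 := by simp
    _ ≤ _ := by
      refine Finset.sum_le_sum fun q _ ↦ Nat.one_le_iff_ne_zero.mpr (mul_ne_zero ?_ ?_)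
      · have := q.2.1
        have := q.2.2
        exact (Ideal.ramificationIdx_pos (q : Ideal (𝓞 K)) ℤ).ne'
      · have := q.2.1
        have := q.2.2
        exact (Ideal.inertiaDeg_pos (q : Ideal (𝓞 K)) ℤ).ne'

open Ideal UniqueFactorizationMonoid in
/-- An ideal is encoded by `d = [K : ℚ]` positive integers whose product is at most its norm. -/
theorem exists_injOn_ideal_prod_le (K : Type*) [Field K] [NumberField K] :
    ∃ g : Ideal (𝓞 K) → (Fin (Module.finrank ℚ K) → ℕ), Set.InjOn g {A | A ≠ ⊥} ∧
      ∀ A ≠ ⊥, (∀ i, g A i ≠ 0) ∧ ∏ i, g A i ≤ absNorm A := by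
  classical
  have hr (p : ℕ) : ∃ r : Fin (Module.finrank ℚ K) → Ideal (𝓞 K),
      ∀ P : Ideal (𝓞 K), P.IsPrime → P ≠ ⊥ → absNorm (under ℤ P) = p → ∃ i, r i = P := by
    let S : Set (Ideal (𝓞 K)) := {P | P.IsPrime ∧ P ≠ ⊥ ∧ absNorm (under ℤ P) = p}
    have hS (F : Finset (Ideal (𝓞 K))) (hF : (F : Set (Ideal (𝓞 K))) ⊆ S) :
        F.card ≤ Module.finrank ℚ K :=
      card_primes_absNorm_under_le F p fun P hP ↦ hF hP
    have hfin : S.Finite := by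
      by_contra h
      obtain ⟨F, h1, h2⟩ := (show S.Infinite from h).exists_subset_card_eq (Module.finrank ℚ K + 1)
      have := hS F h1
      omega
    have hc := hS hfin.toFinset (by simp)
    have : Nonempty (Fin (Module.finrank ℚ K)) := ⟨⟨0, Module.finrank_pos⟩⟩
    have hcard : Fintype.card hfin.toFinset ≤ Fintype.card (Fin (Module.finrank ℚ K)) := by
      simpa using hc
    obtain ⟨f⟩ := Function.Embedding.nonempty_of_card_le hcard
    refine ⟨fun i ↦ if h : ∃ P, f P = i then h.choose else ⊥, fun P h1 h2 h3 ↦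
      ⟨f ⟨P, hfin.mem_toFinset.mpr ⟨h1, h2, h3⟩⟩, ?_⟩⟩
    have h : ∃ Q, f Q = f ⟨P, hfin.mem_toFinset.mpr ⟨h1, h2, h3⟩⟩ := ⟨_, rfl⟩
    simp only [dif_pos h]
    rw [f.injective h.choose_spec]
  choose r hr using hr
  have hidx (P : Ideal (𝓞 K)) : ∃ i, P.IsPrime → P ≠ ⊥ → r (absNorm (under ℤ P)) i = P := by
    by_cases h : P.IsPrime ∧ P ≠ ⊥
    · obtain ⟨i, hi⟩ := hr _ P h.1 h.2 rfl
      exact ⟨i, fun _ _ ↦ hi⟩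
    · exact ⟨⟨0, Module.finrank_pos⟩, fun h1 h2 ↦ (h ⟨h1, h2⟩).elim⟩
  choose idx hidx using hidx
  let m : Ideal (𝓞 K) → Fin (Module.finrank ℚ K) → Multiset ℕ := fun A i ↦
    ((normalizedFactors A).filter (idx · = i)).map fun P ↦ absNorm (under ℤ P)
  have hprime {A P : Ideal (𝓞 K)} (hP : P ∈ normalizedFactors A) :
      P.IsPrime ∧ P ≠ ⊥ ∧ (absNorm (under ℤ P)).Prime := by
    have h0 := prime_of_normalized_factor P hP
    have h1 := Ideal.isPrime_of_prime h0
    have : NeZero P := ⟨h0.ne_zero⟩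
    exact ⟨h1, h0.ne_zero, Nat.absNorm_under_prime P⟩
  have hm {A : Ideal (𝓞 K)} {i} {x : ℕ} (hx : x ∈ m A i) : x.Prime := by
    obtain ⟨P, hP, rfl⟩ := Multiset.mem_map.mp hx
    exact (hprime (Multiset.mem_of_mem_filter hP)).2.2
  refine ⟨fun A i ↦ (m A i).prod, ?_, fun A hA ↦ ⟨fun i ↦ ?_, ?_⟩⟩
  · intro A hA A' hA' hAA'
    have hfilter (A : Ideal (𝓞 K)) (i) : (normalizedFactors A).filter (idx · = i) =
        (normalizedFactors (m A i).prod).map fun p ↦ r p i := by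
      rw [normalizedFactors_prod_of_prime fun p hp ↦ (hm hp).prime, Multiset.map_map]
      refine (Multiset.map_id _).symm.trans (Multiset.map_congr rfl fun P hP ↦ ?_)
      obtain ⟨h1, h2⟩ := Multiset.mem_filter.mp hP
      subst h2
      exact (hidx P (hprime h1).1 (hprime h1).2.1).symm
    have : normalizedFactors A = normalizedFactors A' := by
      ext P
      have h := congr_arg (Multiset.count P) (hfilter A (idx P))
      have e : (m A (idx P)).prod = (m A' (idx P)).prod := congr_fun hAA' _
      rw [e, ← hfilter A' (idx P), Multiset.count_filter_of_pos (p := (idx · = idx P)) rfl,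
        Multiset.count_filter_of_pos (p := (idx · = idx P)) rfl] at h
      exact h
    rw [← Ideal.prod_normalizedFactors_eq_self hA, this, Ideal.prod_normalizedFactors_eq_self hA']
  · exact Multiset.prod_ne_zero fun h ↦ (hm h).ne_zero rfl
  · have h1 : ∏ i, (m A i).prod =
        ((normalizedFactors A).map fun P ↦ absNorm (under ℤ P)).prod := by
      simp only [m]
      induction normalizedFactors A using Multiset.induction_on with
      | empty => simp
      | cons P S ih =>
        rw [Multiset.map_cons, Multiset.prod_cons, ← ih,
          ← Finset.prod_ite_eq_of_mem' Finset.univ (idx P) (fun _ ↦ absNorm (under ℤ P))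
            (Finset.mem_univ _), ← Finset.prod_mul_distrib]
        refine Finset.prod_congr rfl fun i _ ↦ ?_
        by_cases h : idx P = i
        · rw [Multiset.filter_cons_of_pos (p := (idx · = i)) _ h, if_pos h.symm, Multiset.map_cons, Multiset.prod_cons]
        · rw [Multiset.filter_cons_of_neg (p := (idx · = i)) _ h, if_neg (Ne.symm h), one_mul]
    have h2 : absNorm A = ((normalizedFactors A).map absNorm).prod := by
      conv_lhs => rw [← Ideal.prod_normalizedFactors_eq_self hA]
      exact map_multiset_prod _ _
    rw [h1, h2]
    refine Multiset.prod_map_le_prod_map₀ _ _ (fun _ _ ↦ Nat.zero_le _) fun P hP ↦ ?_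
    refine Nat.le_of_dvd (Nat.pos_of_ne_zero ?_) (Int.absNorm_under_dvd_absNorm P)
    exact absNorm_ne_zero_iff_mem_nonZeroDivisors.mpr (mem_nonZeroDivisors_of_ne_zero (hprime hP).2.1)

/-- Rankin's bound for the number of tuples of positive integers of bounded product. -/
theorem card_le_rpow_mul_tsum_pow {α ι : Type*} [Fintype ι] {s : ℝ} (hs : 1 < s)
    {N : ℝ} (hN : 0 ≤ N) (F : Finset α) (g : α → ι → ℕ) (hg : Set.InjOn g F)
    (hg0 : ∀ A ∈ F, ∀ i, g A i ≠ 0) (hgN : ∀ A ∈ F, ((∏ i, g A i : ℕ) : ℝ) ≤ N) :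
    (F.card : ℝ) ≤ N ^ s * (∑' n : ℕ, 1 / (n : ℝ) ^ s) ^ Fintype.card ι := by
  classical
  set T := Fintype.piFinset fun _ : ι ↦ Finset.range (⌊N⌋₊ + 1)
  have hs' := Real.summable_one_div_nat_rpow.mpr hs
  let φ : (ι → ℕ) → ℝ := fun x ↦ N ^ s * ∏ i, 1 / (x i : ℝ) ^ s
  have hφ (x) : 0 ≤ φ x := by positivity
  have hone : ∀ A ∈ F, (1 : ℝ) ≤ φ (g A) := by
    intro A hA
    have hpos : (0 : ℝ) < ∏ i, (g A i : ℝ) :=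
      Finset.prod_pos fun i _ ↦ Nat.cast_pos.mpr (Nat.pos_of_ne_zero (hg0 A hA i))
    simp only [φ]
    rw [Finset.prod_div_distrib, Finset.prod_const_one,
      Real.finsetProd_rpow _ _ (fun i _ ↦ by positivity), mul_one_div, one_le_div (by positivity)]
    refine Real.rpow_le_rpow hpos.le (le_trans ?_ (hgN A hA)) (by linarith)
    exact_mod_cast le_rfl
  have hsub : F.image g ⊆ T := by
    intro x hx
    obtain ⟨A, hA, rfl⟩ := Finset.mem_image.mp hx
    refine Fintype.mem_piFinset.mpr fun i ↦ Finset.mem_range.mpr (Nat.lt_succ_of_le ?_)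
    refine le_trans (Finset.single_le_prod' (f := g A)
      (fun i _ ↦ Nat.one_le_iff_ne_zero.mpr (hg0 A hA i)) (Finset.mem_univ i)) ?_
    exact Nat.le_floor (hgN A hA)
  have hT : ∑ x ∈ T, φ x =
      N ^ s * (∑ n ∈ Finset.range (⌊N⌋₊ + 1), 1 / (n : ℝ) ^ s) ^ Fintype.card ι := by
    have h := Finset.prod_univ_sum (fun _ : ι ↦ Finset.range (⌊N⌋₊ + 1))
      fun _ n ↦ 1 / (n : ℝ) ^ s
    simp only [φ]
    rw [← Finset.mul_sum, ← h]
    simp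
  calc (F.card : ℝ) = ∑ A ∈ F, 1 := by simp
    _ ≤ ∑ A ∈ F, φ (g A) := Finset.sum_le_sum hone
    _ = ∑ x ∈ F.image g, φ x := (Finset.sum_image hg).symm
    _ ≤ ∑ x ∈ T, φ x := Finset.sum_le_sum_of_subset_of_nonneg hsub fun _ _ _ ↦ hφ _
    _ = _ := hT
    _ ≤ _ := by
        gcongr
        exact hs'.sum_le_tsum _ fun _ _ ↦ by positivity

open Ideal in
/-- Rankin's bound for the number of integral ideals of bounded norm. -/
theorem card_ideal_absNorm_le {s : ℝ} (hs : 1 < s) {N : ℝ} (hN : 0 ≤ N)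
    (F : Finset (Ideal (𝓞 K))) (hF : ∀ A ∈ F, A ≠ ⊥ ∧ absNorm A ≤ N) :
    (F.card : ℝ) ≤ N ^ s * (∑' n : ℕ, 1 / (n : ℝ) ^ s) ^ Module.finrank ℚ K := by
  obtain ⟨g, hg, hg2⟩ := exists_injOn_ideal_prod_le K
  have h := card_le_rpow_mul_tsum_pow hs hN F g (hg.mono fun A hA ↦ (hF A hA).1)
    (fun A hA ↦ (hg2 A (hF A hA).1).1)
    fun A hA ↦ (Nat.cast_le.mpr (hg2 A (hF A hA).1).2).trans (hF A hA).2
  rwa [Fintype.card_fin] at h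
end IdealCount

section Minkowski
variable {K : Type*} [Field K] [NumberField K]

open NumberField.mixedEmbedding NumberField.InfinitePlace MeasureTheory Module ENNReal in
open scoped nonZeroDivisors NNReal Classical in
/-- Minkowski's theorem for an ideal and a box, with an explicit but not optimal constant. -/
theorem exists_mem_ideal_forall_infinitePlace_lt {I : Ideal (𝓞 K)} (hI : I ≠ ⊥)
    {f : InfinitePlace K → ℝ} (hf : ∀ w, 0 ≤ f w)
    (h : 2 ^ finrank ℚ K * √|(discr K : ℝ)| * Ideal.absNorm I < ∏ w, f w ^ w.mult) :
    ∃ β ∈ I, β ≠ 0 ∧ ∀ w : InfinitePlace K, w β < f w := by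
  lift f to InfinitePlace K → ℝ≥0 using hf
  let J : (FractionalIdeal (𝓞 K)⁰ K)ˣ :=
    FractionalIdeal.mk0 K ⟨I, mem_nonZeroDivisors_of_ne_zero hI⟩
  have hJ : minkowskiBound K J < volume (convexBodyLT K f) := by
    rw [convexBodyLT_volume]
    refine lt_of_lt_of_le (b := ∏ w, (f w : ℝ≥0∞) ^ w.mult) ?_ ?_
    · rw [minkowskiBound, volume_fundamentalDomain_fractionalIdealLatticeBasis,
        volume_fundamentalDomain_latticeBasis, mixedEmbedding.finrank]
      have e : (FractionalIdeal.absNorm (J : FractionalIdeal (𝓞 K)⁰ K)) = Ideal.absNorm I := by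
        rw [FractionalIdeal.coe_mk0, FractionalIdeal.coeIdeal_absNorm]
      rw [e]
      refine lt_of_le_of_lt (b := ENNReal.ofReal (2 ^ finrank ℚ K * √|(discr K : ℝ)| * Ideal.absNorm I)) ?_ ?_
      · have h2 : ((NNReal.sqrt ‖discr K‖₊ : ℝ≥0) : ℝ≥0∞) = ENNReal.ofReal √|(discr K : ℝ)| := by
          rw [← ENNReal.ofReal_coe_nnreal, Real.coe_sqrt, coe_nnnorm, Int.norm_eq_abs]
        have h3 : ((2 : ℝ≥0∞)⁻¹) ^ nrComplexPlaces K ≤ 1 := pow_le_one₀ (by positivity) (by simp)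
        rw [h2, ENNReal.ofReal_mul (by positivity), ENNReal.ofReal_mul (by positivity),
          ENNReal.ofReal_pow (by norm_num), ENNReal.ofReal_ofNat]
        calc _ ≤ ENNReal.ofReal ((Ideal.absNorm I : ℚ) : ℝ) *
              (1 * ENNReal.ofReal √|(discr K : ℝ)|) * 2 ^ finrank ℚ K := by gcongr
          _ = _ := by push_cast; ring
      · have : (∏ w, (f w : ℝ≥0∞) ^ w.mult) = ENNReal.ofReal (∏ w, (f w : ℝ) ^ w.mult) := by
          rw [ENNReal.ofReal_prod_of_nonneg fun _ _ ↦ by positivity]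
          refine Finset.prod_congr rfl fun w _ ↦ ?_
          rw [ENNReal.ofReal_pow (by positivity), ENNReal.ofReal_coe_nnreal]
        rw [this]
        exact (ENNReal.ofReal_lt_ofReal_iff_of_nonneg (by positivity)).mpr h
    · have h1 := one_le_convexBodyLTFactor K
      calc _ = (1 : ℝ≥0∞) * ∏ w, (f w : ℝ≥0∞) ^ w.mult := (one_mul _).symm
        _ ≤ _ := by
          gcongr
          · exact_mod_cast h1
          · exact le_of_eq (by push_cast; rfl)
  obtain ⟨a, ha, ha0, hlt⟩ := exists_ne_zero_mem_ideal_lt K J hJ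
  have ha' : a ∈ (I : FractionalIdeal (𝓞 K)⁰ K) := by simpa [J] using ha
  obtain ⟨β, hβ, rfl⟩ := (FractionalIdeal.mem_coeIdeal _).mp ha'
  refine ⟨β, hβ, ?_, hlt⟩
  rintro rfl
  simp at ha0

end Minkowski

section Counting
variable {K : Type*} [Field K] [NumberField K]

open NumberField.InfinitePlace Module in
theorem card_infinitePlace_le_finrank : Fintype.card (InfinitePlace K) ≤ finrank ℚ K := by
  rw [← sum_mult_eq, Fintype.card_eq_sum_ones]
  exact Finset.sum_le_sum fun w _ ↦ mult_pos

/-- If the weighted sum of `x` is nonnegative and `x` is bounded above, then it is bounded below. -/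
theorem neg_le_of_sum_mul_nonneg {ι : Type*} [Fintype ι] {m : ι → ℕ} (hm : ∀ i, 0 < m i)
    {x : ι → ℝ} {L : ℝ} (hL : 0 ≤ L) (hx : ∀ i, x i ≤ L) (hsum : 0 ≤ ∑ i, m i * x i) (i : ι) :
    -((∑ j, m j : ℕ) * L) ≤ x i := by
  classical
  rcases le_or_gt 0 (x i) with h | h
  · exact le_trans (neg_nonpos.mpr (by positivity)) h
  have h1 : ∑ j ∈ Finset.univ.erase i, m j * x j ≤ ∑ j, (m j : ℝ) * L :=
    calc _ ≤ ∑ j ∈ Finset.univ.erase i, (m j : ℝ) * L := by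
          refine Finset.sum_le_sum fun j _ ↦ ?_
          gcongr
          exact hx j
      _ ≤ _ := Finset.sum_le_sum_of_subset_of_nonneg (Finset.subset_univ _)
          fun _ _ _ ↦ by positivity
  rw [← Finset.add_sum_erase _ _ (Finset.mem_univ i)] at hsum
  rw [← Finset.sum_mul] at h1
  have h2 : (1 : ℝ) ≤ m i := by exact_mod_cast hm i
  push_cast
  nlinarith

open NumberField.InfinitePlace Module Ideal in
theorem exists_small_element {ℓ : ℕ} (hℓ : 0 < ℓ) {J P : Ideal (𝓞 K)} (hJ : J ≠ ⊥) (hP : P ≠ ⊥)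
    {γ : 𝓞 K} (hγ : J ^ ℓ = span {γ}) {R : ℝ} (hR : R = 2 * (2 ^ finrank ℚ K * √|(discr K : ℝ)|)) :
    ∃ (A : Ideal (𝓞 K)) (β : 𝓞 K), A ≠ ⊥ ∧ β ≠ 0 ∧ A * J * P = span {β} ∧ absNorm A ≤ R ∧
      ∀ w : InfinitePlace K, |Real.log (w β ^ ℓ / w γ)| ≤ ℓ * Real.log (R * absNorm P) := by
  have hγ0 : γ ≠ 0 := by
    rintro rfl
    exact pow_ne_zero ℓ hJ (by simpa using hγ)
  have hN {I : Ideal (𝓞 K)} (hI : I ≠ ⊥) : (1 : ℝ) ≤ absNorm I := by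
    exact_mod_cast Nat.one_le_iff_ne_zero.mpr (mt Ideal.absNorm_eq_zero_iff.mp hI)
  have hnorm (x : 𝓞 K) : ∏ w : InfinitePlace K, w x ^ w.mult = (absNorm (span {x}) : ℝ) := by
    rw [InfinitePlace.prod_eq_abs_norm, absNorm_span_singleton, ← Algebra.coe_norm_int, Nat.cast_natAbs]
    push_cast
    rfl
  have hwγ (w : InfinitePlace K) : 0 < w γ := InfinitePlace.pos_iff.mpr (by simpa using hγ0)
  have hR1 : 1 ≤ R := by
    have h1 : (1 : ℝ) ≤ √|(discr K : ℝ)| := by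
      rw [Real.one_le_sqrt]
      exact_mod_cast Int.one_le_abs (discr_ne_zero K)
    have h2 : (1 : ℝ) ≤ 2 ^ finrank ℚ K := one_le_pow₀ (by norm_num)
    nlinarith
  have hd : (finrank ℚ K : ℝ) ≠ 0 := by exact_mod_cast finrank_pos.ne'
  set T := R * absNorm P with hT
  have hT1 : 1 ≤ T := by nlinarith [hN hP]
  let f : InfinitePlace K → ℝ := fun w ↦ T ^ (1 / finrank ℚ K : ℝ) * w γ ^ (1 / ℓ : ℝ)
  have hfprod : ∏ w, f w ^ w.mult = T * absNorm J := by
    simp only [f, mul_pow, Finset.prod_mul_distrib]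
    congr 1
    · rw [Finset.prod_pow_eq_pow_sum, sum_mult_eq, ← Real.rpow_natCast, ← Real.rpow_mul (by positivity),
        one_div_mul_cancel hd, Real.rpow_one]
    · have h1 (w : InfinitePlace K) : (w γ ^ (1 / ℓ : ℝ)) ^ w.mult = (w γ ^ w.mult) ^ (1 / ℓ : ℝ) := by
        rw [← Real.rpow_natCast, ← Real.rpow_natCast, ← Real.rpow_mul (hwγ w).le,
          ← Real.rpow_mul (hwγ w).le, mul_comm]
      simp only [h1]
      rw [Real.finsetProd_rpow _ _ (fun w _ ↦ by positivity), hnorm, ← hγ, map_pow]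
      push_cast
      rw [one_div, Real.pow_rpow_inv_natCast (by positivity) hℓ.ne']
  obtain ⟨β, hβ, hβ0, hlt⟩ := exists_mem_ideal_forall_infinitePlace_lt (mul_ne_zero hJ hP)
    (f := f) (fun w ↦ by positivity) (by
      rw [hfprod, hT, map_mul, hR]
      push_cast
      have h1 : 0 < 2 ^ finrank ℚ K * √|(discr K : ℝ)| := by linarith
      have h2 := mul_pos h1 (mul_pos (zero_lt_one.trans_le (hN hJ)) (zero_lt_one.trans_le (hN hP)))
      linarith)
  obtain ⟨A, hA⟩ := Ideal.dvd_iff_le.mpr ((span_singleton_le_iff_mem _).mpr hβ)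
  have hwβ (w : InfinitePlace K) : 0 < w β := InfinitePlace.pos_iff.mpr (by simpa using hβ0)
  have hA0 : A ≠ ⊥ := by
    rintro rfl
    simp [hβ0] at hA
  have hNβ : (absNorm (span {β}) : ℝ) = absNorm A * absNorm J * absNorm P := by
    rw [hA]
    push_cast [map_mul]
    ring
  refine ⟨A, β, hA0, hβ0, by rw [hA]; ring, ?_, fun w ↦ ?_⟩
  · have h1 : (absNorm (span {β}) : ℝ) ≤ T * absNorm J := by
      rw [← hfprod, ← hnorm]
      exact Finset.prod_le_prod (fun w _ ↦ by positivity) fun w _ ↦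
        pow_le_pow_left₀ (hwβ w).le (hlt w).le _
    rw [hNβ, hT] at h1
    refine le_of_mul_le_mul_right (?_ : _ ≤ R * (absNorm J * absNorm P : ℝ)) ?_
    · linarith
    · exact mul_pos (zero_lt_one.trans_le (hN hJ)) (zero_lt_one.trans_le (hN hP))
  · have hlog (w : InfinitePlace K) :
        Real.log (w β ^ ℓ / w γ) ≤ ℓ / finrank ℚ K * Real.log T := by
      have h1 := Real.log_le_log (hwβ w) (hlt w).le
      rw [Real.log_mul (by positivity) (by have := hwγ w; positivity),
        Real.log_rpow (by positivity), Real.log_rpow (hwγ w)] at h1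
      rw [Real.log_div (by have := hwβ w; positivity) (hwγ w).ne', Real.log_pow]
      have hl : (0 : ℝ) < ℓ := by exact_mod_cast hℓ
      have h2 := mul_le_mul_of_nonneg_left h1 hl.le
      have h3 : (ℓ : ℝ) * (1 / finrank ℚ K * Real.log T + 1 / ℓ * Real.log (w γ)) =
          ℓ / finrank ℚ K * Real.log T + Real.log (w γ) := by field_simp
      linarith
    have hsum : 0 ≤ ∑ w : InfinitePlace K, (w.mult : ℝ) * Real.log (w β ^ ℓ / w γ) := by
      have h1 : ∑ w : InfinitePlace K, (w.mult : ℝ) * Real.log (w β ^ ℓ / w γ) =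
          Real.log (∏ w : InfinitePlace K, (w β ^ ℓ / w γ) ^ w.mult) := by
        rw [Real.log_prod fun w _ ↦ by have := hwβ w; have := hwγ w; positivity]
        simp only [Real.log_pow]
      rw [h1]
      refine Real.log_nonneg ?_
      have h2 (w : InfinitePlace K) :
          (w β ^ ℓ / w γ) ^ w.mult = (w β ^ w.mult) ^ ℓ / w γ ^ w.mult := by
        rw [div_pow, ← pow_mul, ← pow_mul, mul_comm]
      simp only [h2]
      rw [Finset.prod_div_distrib, Finset.prod_pow, hnorm, hnorm, ← hγ, hNβ, map_pow]
      push_cast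
      have h3 := zero_lt_one.trans_le (hN hJ)
      rw [one_le_div (by positivity)]
      gcongr
      nlinarith [hN hA0, hN hP, mul_le_mul (hN hA0) (hN hP) zero_le_one (by positivity)]
    have hlT := Real.log_nonneg hT1
    have h1 := neg_le_of_sum_mul_nonneg (m := fun w : InfinitePlace K ↦ w.mult)
      (fun _ ↦ mult_pos) (by positivity) hlog hsum w
    rw [sum_mult_eq, ← mul_assoc, mul_div_cancel₀ _ hd] at h1
    refine abs_le.mpr ⟨h1, (hlog w).trans ?_⟩
    gcongr
    exact div_le_self (by positivity) (by exact_mod_cast finrank_pos)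

open NumberField.InfinitePlace Module Ideal in
/-- The Ellenberg and Venkatesh counting argument: a family of ideals of small norm whose `ℓ`-th powers
are pairwise not related by an element of small height forces the `ℓ`-torsion to be small. -/
theorem card_torsion_mul_card_le {ℓ : ℕ} (hℓ : 0 < ℓ) {ι : Type*} (S : Finset ι)
    {P : ι → Ideal (𝓞 K)} (hP : ∀ i ∈ S, P i ≠ ⊥) {R Y : ℝ}
    (hR : R = 2 * (2 ^ finrank ℚ K * √|(discr K : ℝ)|)) (hY1 : 1 ≤ Y)
    (hY : ∀ i ∈ S, absNorm (P i) ≤ Y)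
    (hsep : ∀ i ∈ S, ∀ j ∈ S, ∀ u w : 𝓞 K, u ≠ 0 → w ≠ 0 →
      span {u} * P i ^ ℓ = span {w} * P j ^ ℓ →
      (∀ v : InfinitePlace K, v u ≤ Real.exp 1 * v w) → i = j)
    {s : ℝ} (hs : 1 < s) :
    (Nat.card {c : ClassGroup (𝓞 K) // c ^ ℓ = 1} : ℝ) * S.card ≤
      R ^ s * (∑' n : ℕ, 1 / (n : ℝ) ^ s) ^ finrank ℚ K *
        (2 * (ℓ * Real.log (R * Y)) + 2) ^ finrank ℚ K := by
  classical
  have hrep (c : {c : ClassGroup (𝓞 K) // c ^ ℓ = 1}) : ∃ J : Ideal (𝓞 K), ∃ hJ : J ≠ ⊥,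
      ClassGroup.mk0 ⟨J, mem_nonZeroDivisors_of_ne_zero hJ⟩ = c.1 ∧
      ∃ γ : 𝓞 K, γ ≠ 0 ∧ J ^ ℓ = span {γ} := by
    obtain ⟨J, hJ⟩ := ClassGroup.mk0_surjective c.1
    have hJ0 : (J : Ideal (𝓞 K)) ≠ ⊥ := nonZeroDivisors.ne_zero J.2
    refine ⟨J, hJ0, hJ, ?_⟩
    have h1 : ClassGroup.mk0 (J ^ ℓ) = 1 := by rw [map_pow, hJ, c.2]
    rw [ClassGroup.mk0_eq_one_iff] at h1
    obtain ⟨γ, hγ⟩ := h1.principal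
    have hγ' : (J : Ideal (𝓞 K)) ^ ℓ = span {γ} := by simpa using hγ
    refine ⟨γ, ?_, hγ'⟩
    rintro rfl
    exact pow_ne_zero ℓ hJ0 (by simpa using hγ')
  choose J hJ0 hJc γ hγ0 hγ using hrep
  have hex (x : {c : ClassGroup (𝓞 K) // c ^ ℓ = 1} × S) :=
    exists_small_element hℓ (hJ0 x.1) (hP x.2 x.2.2) (hγ x.1) hR
  choose A β hA0 hβ0 hAβ hAR hlog using hex
  have hR1 : 1 ≤ R := by
    have h1 : (1 : ℝ) ≤ √|(discr K : ℝ)| := by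
      rw [Real.one_le_sqrt]
      exact_mod_cast Int.one_le_abs (discr_ne_zero K)
    have h2 : (1 : ℝ) ≤ 2 ^ finrank ℚ K := one_le_pow₀ (by norm_num)
    nlinarith
  set L : ℝ := ℓ * Real.log (R * Y) with hL
  have hlogL (x) (w : InfinitePlace K) : |Real.log (w (β x) ^ ℓ / w (γ x.1))| ≤ L := by
    refine (hlog x w).trans ?_
    have h1 : (1 : ℝ) ≤ absNorm (P x.2) := by
      exact_mod_cast Nat.one_le_iff_ne_zero.mpr
        (mt Ideal.absNorm_eq_zero_iff.mp (hP x.2 x.2.2))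
    have h2 := hY x.2 x.2.2
    rw [hL]
    gcongr
  let lam : {c : ClassGroup (𝓞 K) // c ^ ℓ = 1} × S → InfinitePlace K → ℤ :=
    fun x w ↦ ⌊Real.log (w (β x) ^ ℓ / w (γ x.1))⌋
  have hinj : Function.Injective fun x ↦ (A x, lam x) := by
    intro x y hxy
    obtain ⟨hA, hl⟩ := Prod.ext_iff.mp hxy
    simp only at hA hl
    have hle (x y) (hl : lam x = lam y) (v : InfinitePlace K) :
        v (γ x.1 * β y ^ ℓ : 𝓞 K) ≤ Real.exp 1 * v (γ y.1 * β x ^ ℓ : 𝓞 K) := by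
      have hpos {z : 𝓞 K} (hz : z ≠ 0) : 0 < v z := InfinitePlace.pos_iff.mpr (by simpa using hz)
      have g1 := hpos (hγ0 x.1)
      have g2 := hpos (hγ0 y.1)
      have b1 := hpos (hβ0 x)
      have b2 := hpos (hβ0 y)
      have h1 : Real.log (v (β y) ^ ℓ / v (γ y.1)) ≤ 1 + Real.log (v (β x) ^ ℓ / v (γ x.1)) := by
        have h2 : ⌊Real.log (v (β x) ^ ℓ / v (γ x.1))⌋ = ⌊Real.log (v (β y) ^ ℓ / v (γ y.1))⌋ :=
          congr_fun hl v
        have h3 := Int.floor_le (Real.log (v (β x) ^ ℓ / v (γ x.1)))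
        have h4 := Int.lt_floor_add_one (Real.log (v (β y) ^ ℓ / v (γ y.1)))
        rw [← h2] at h4
        linarith
      rw [← Real.exp_le_exp, Real.exp_add, Real.exp_log (by positivity),
        Real.exp_log (by positivity), mul_div_assoc', div_le_div_iff₀ g2 g1] at h1
      push_cast
      simp only [map_mul, map_pow]
      linarith
    have hspan : span {γ x.1 * β y ^ ℓ} * P x.2 ^ ℓ = span {γ y.1 * β x ^ ℓ} * P y.2 ^ ℓ := by
      rw [← span_singleton_mul_span_singleton, ← span_singleton_mul_span_singleton,
        ← span_singleton_pow, ← span_singleton_pow, ← hγ, ← hγ, ← hAβ, ← hAβ, hA]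
      ring
    have hi : x.2 = y.2 := Subtype.ext <| hsep x.2 x.2.2 y.2 y.2.2 _ _
      (mul_ne_zero (hγ0 _) (pow_ne_zero _ (hβ0 _))) (mul_ne_zero (hγ0 _) (pow_ne_zero _ (hβ0 _)))
      hspan (hle x y hl)
    have hc : x.1 = y.1 := by
      refine Subtype.ext ?_
      rw [← hJc, ← hJc, ClassGroup.mk0_eq_mk0_iff]
      refine ⟨β y, β x, hβ0 y, hβ0 x, ?_⟩
      change span {β y} * J x.1 = span {β x} * J y.1
      rw [← hAβ, ← hAβ, hA, hi]
      ring
    exact Prod.ext hc hi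
  let B : Finset (InfinitePlace K → ℤ) := Fintype.piFinset fun _ ↦ Finset.Icc ⌊-L⌋ ⌊L⌋
  have hL0 : 0 ≤ L := mul_nonneg (by positivity) (Real.log_nonneg (by nlinarith))
  have hB : (B.card : ℝ) ≤ (2 * L + 2) ^ finrank ℚ K := by
    rw [Fintype.card_piFinset, Finset.prod_const, Finset.card_univ, Nat.cast_pow, Int.card_Icc]
    have h1 : ((⌊L⌋ + 1 - ⌊-L⌋).toNat : ℝ) ≤ 2 * L + 2 := by
      have h2 : (((⌊L⌋ + 1 - ⌊-L⌋).toNat : ℤ) : ℝ) ≤ 2 * L + 2 := by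
        rw [Int.toNat_of_nonneg]
        · push_cast
          linarith [Int.floor_le L, Int.lt_floor_add_one (-L)]
        · have := Int.floor_le_floor (show -L ≤ L by linarith)
          lia
      exact_mod_cast h2
    calc _ ≤ (2 * L + 2) ^ Fintype.card (InfinitePlace K) := by gcongr
      _ ≤ _ := pow_le_pow_right₀ (by linarith) card_infinitePlace_le_finrank
  let U : Finset ({c : ClassGroup (𝓞 K) // c ^ ℓ = 1} × S) := Finset.univ
  have hU : (U.card : ℝ) = (Nat.card {c : ClassGroup (𝓞 K) // c ^ ℓ = 1} : ℝ) * S.card := by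
    simp [U]
  rw [← hU]
  calc (U.card : ℝ) ≤ ((U.image A ×ˢ B).card : ℝ) := by
        refine Nat.cast_le.mpr (Finset.card_le_card_of_injOn _ ?_ hinj.injOn)
        intro x _
        refine Finset.mem_coe.mpr (Finset.mem_product.mpr ⟨Finset.mem_image_of_mem _ (Finset.mem_univ _),
          Fintype.mem_piFinset.mpr fun w ↦ Finset.mem_Icc.mpr ⟨?_, ?_⟩⟩)
        · exact Int.floor_le_floor (abs_le.mp (hlogL x w)).1
        · exact Int.floor_le_floor (abs_le.mp (hlogL x w)).2
    _ = ((U.image A).card : ℝ) * B.card := by rw [Finset.card_product, Nat.cast_mul]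
    _ ≤ _ := by
        gcongr
        refine card_ideal_absNorm_le hs (by linarith) _ fun I hI ↦ ?_
        obtain ⟨x, _, rfl⟩ := Finset.mem_image.mp hI
        exact ⟨hA0 x, hAR x⟩
end Counting

section PowerBasis
variable {F L : Type*} [Field F] [Field L] [Algebra F L]

theorem PowerBasis.trace_gen_pow_eq_zero (pb : PowerBasis F L) {a : F}
    (ha : pb.gen ^ pb.dim = algebraMap F L a) {m : ℕ} (hm : ¬ pb.dim ∣ m) :
    Algebra.trace F L (pb.gen ^ m) = 0 := by
  have h1 : pb.gen ^ m = a ^ (m / pb.dim) • pb.gen ^ (m % pb.dim) := by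
    conv_lhs => rw [← Nat.mod_add_div m pb.dim]
    rw [pow_add, pow_mul, ha, ← map_pow, mul_comm, Algebra.smul_def]
  have hr : 0 < m % pb.dim := Nat.pos_of_ne_zero fun h ↦ hm (Nat.dvd_of_mod_eq_zero h)
  have hr2 : m % pb.dim < pb.dim := Nat.mod_lt _ pb.dim_pos
  rw [h1, map_smul, smul_eq_mul]
  refine mul_eq_zero_of_right _ ?_
  set r := m % pb.dim
  rw [Algebra.trace_eq_matrix_trace pb.basis]
  refine Finset.sum_eq_zero fun k _ ↦ ?_
  rw [Matrix.diag_apply, Algebra.leftMulMatrix_eq_repr_mul, pb.basis_eq_pow, ← pow_add]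
  by_cases h : r + k < pb.dim
  · have h2 := pb.basis_eq_pow ⟨r + k, h⟩
    simp only at h2
    rw [← h2, Module.Basis.repr_self, Finsupp.single_apply, if_neg]
    intro h3
    have := congr_arg Fin.val h3
    simp only at this
    lia
  · have h3 : r + k - pb.dim < pb.dim := by have := k.2; lia
    have h2 := pb.basis_eq_pow ⟨r + k - pb.dim, h3⟩
    simp only at h2
    have h4 : pb.gen ^ (r + (k : ℕ)) = a • pb.gen ^ (r + k - pb.dim) := by
      rw [Algebra.smul_def, ← ha, ← pow_add]
      congr 1
      lia
    rw [h4, ← h2, map_smul, Module.Basis.repr_self, Finsupp.smul_apply, Finsupp.single_apply,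
      if_neg, smul_zero]
    intro h5
    have := congr_arg Fin.val h5
    simp only at this
    lia

theorem PowerBasis.trace_algebraMap_dim (pb : PowerBasis F L) (x : F) :
    Algebra.trace F L (algebraMap F L x) = pb.dim * x := by
  rw [Algebra.trace_algebraMap, pb.finrank, nsmul_eq_mul]

/-- The dual basis expansion with respect to the powers of a pure generator. -/
theorem PowerBasis.mul_eq_sum_trace_mul (pb : PowerBasis F L) {a : F}
    (ha : pb.gen ^ pb.dim = algebraMap F L a) (z : L) :
    algebraMap F L (pb.dim * a) * z = ∑ k ∈ Finset.range pb.dim,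
      algebraMap F L (Algebra.trace F L (z * pb.gen ^ (pb.dim - k))) * pb.gen ^ k := by
  let φ : L →ₗ[F] L := ∑ k ∈ Finset.range pb.dim,
    ((Algebra.trace F L).comp (LinearMap.mulRight F (pb.gen ^ (pb.dim - k)))).smulRight (pb.gen ^ k)
  have h : LinearMap.mulLeft F (algebraMap F L (pb.dim * a)) = φ := by
    refine pb.basis.ext fun j ↦ ?_
    simp only [φ, LinearMap.mulLeft_apply, LinearMap.sum_apply, LinearMap.smulRight_apply,
      LinearMap.comp_apply, LinearMap.mulRight_apply, pb.basis_eq_pow]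
    rw [Finset.sum_eq_single_of_mem (j : ℕ) (Finset.mem_range.mpr j.2)]
    · rw [← pow_add, Nat.add_sub_cancel' j.2.le, ha, pb.trace_algebraMap_dim, Algebra.smul_def]
    · intro k hk hkj
      have := Finset.mem_range.mp hk
      rw [← pow_add, pb.trace_gen_pow_eq_zero ha, zero_smul]
      rintro ⟨q, hq⟩
      have hj := j.2
      rcases q with _ | _ | q
      · lia
      · lia
      · rw [mul_add, mul_add] at hq
        lia
  have h2 := LinearMap.congr_fun h z
  simpa [φ, Algebra.smul_def, mul_assoc] using h2
end PowerBasis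

section Trace
variable {K : Type*} [Field K] [NumberField K]

/-- The trace of an element which is nilpotent modulo a squarefree integer is divisible by it. -/
theorem dvd_trace_of_dvd_pow {a d : ℕ} (ha : Squarefree a) {x : 𝓞 K} (h : (a : 𝓞 K) ∣ x ^ d) :
    (a : ℤ) ∣ Algebra.trace ℤ (𝓞 K) x := by
  classical
  let b := RingOfIntegers.basis K
  obtain ⟨y, hy⟩ := h
  have : IsReduced (ZMod a) := isReduced_zmod.mpr (Or.inl ha)
  let f := Int.castRingHom (ZMod a)
  have h1 : IsNilpotent (f.mapMatrix (Algebra.leftMulMatrix b x)) := by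
    refine ⟨d, ?_⟩
    rw [← map_pow, ← map_pow, hy, map_mul, map_natCast, map_mul, map_natCast]
    have : ((a : ℕ) : Matrix (Module.Free.ChooseBasisIndex ℤ (𝓞 K)) (Module.Free.ChooseBasisIndex ℤ (𝓞 K)) (ZMod a)) = 0 := by
      ext i j
      simp [Matrix.natCast_apply]
    rw [this, zero_mul]
  have h2 := (Matrix.isNilpotent_trace_of_isNilpotent h1).eq_zero
  rw [Algebra.trace_eq_matrix_trace b, ← ZMod.intCast_zmod_eq_zero_iff_dvd]
  rw [← h2, Matrix.trace, Matrix.trace]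
  simp [f]
end Trace

section Discriminant
variable {K : Type*} [Field K] [NumberField K]

theorem PowerBasis.minpoly_gen_eq_of_pow {F L : Type*} [Field F] [Field L] [Algebra F L]
    (pb : PowerBasis F L) {a : F} (ha : pb.gen ^ pb.dim = algebraMap F L a) :
    minpoly F pb.gen = X ^ pb.dim - C a := by
  have hmonic : (X ^ pb.dim - C a).Monic := monic_X_pow_sub_C a pb.dim_pos.ne'
  have hdvd : minpoly F pb.gen ∣ X ^ pb.dim - C a := minpoly.dvd _ _ (by simp [ha])
  have hdeg : (X ^ pb.dim - C a).natDegree ≤ (minpoly F pb.gen).natDegree := by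
    rw [natDegree_X_pow_sub_C, pb.natDegree_minpoly]
  exact (eq_of_monic_of_dvd_of_natDegree_le (minpoly.monic pb.isIntegral_gen) hmonic hdvd hdeg).symm

theorem PowerBasis.abs_discr_eq_of_pow (pb : PowerBasis ℚ K) {a : ℕ}
    (ha : pb.gen ^ pb.dim = a) :
    |Algebra.discr ℚ pb.basis| = pb.dim ^ pb.dim * a ^ (pb.dim - 1) := by
  have hN : |Algebra.norm ℚ pb.gen| = a := by
    have h1 : |Algebra.norm ℚ pb.gen| ^ pb.dim = (a : ℚ) ^ pb.dim := by
      rw [← abs_pow, ← map_pow, ha, ← map_natCast (algebraMap ℚ K), Algebra.norm_algebraMap,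
        pb.finrank, abs_pow, Nat.abs_cast]
    exact (pow_left_inj₀ (abs_nonneg _) (by positivity) pb.dim_pos.ne').mp h1
  have ha' : pb.gen ^ pb.dim = algebraMap ℚ K (a : ℚ) := by rw [ha, map_natCast]
  rw [Algebra.discr_powerBasis_eq_norm, pb.minpoly_gen_eq_of_pow ha', abs_mul, abs_pow, abs_neg,
    abs_one, one_pow, one_mul]
  have h2 : aeval pb.gen (X ^ pb.dim - C (a : ℚ)).derivative =
      algebraMap ℚ K (pb.dim : ℚ) * pb.gen ^ (pb.dim - 1) := by
    simp [derivative_X_pow]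
  rw [h2, map_mul, map_pow, abs_mul, abs_pow, hN, Algebra.norm_algebraMap, pb.finrank, abs_pow,
    Nat.abs_cast]

open scoped Matrix in
theorem PowerBasis.natAbs_discr_le_of_pow (pb : PowerBasis ℚ K) {a : ℕ} (ha0 : 0 < a)
    (ha : pb.gen ^ pb.dim = a) :
    (discr K).natAbs ≤ pb.dim ^ pb.dim * a ^ (pb.dim - 1) := by
  classical
  have hinteg : IsIntegral ℤ pb.gen := by
    refine IsIntegral.of_pow pb.dim_pos ?_
    rw [ha]
    simpa using (isIntegral_algebraMap : IsIntegral ℤ (algebraMap ℤ K a))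
  let ϑ : 𝓞 K := ⟨pb.gen, hinteg⟩
  let e := pb.basis.indexEquiv (integralBasis K)
  let P : Matrix _ _ ℤ := Matrix.of fun i j ↦ (RingOfIntegers.basis K).repr (ϑ ^ (e.symm j : ℕ)) i
  have h1 : integralBasis K ᵥ* ((P.map (Int.cast : ℤ → ℚ)).map (algebraMap ℚ K)) =
      pb.basis ∘ e.symm := by
    ext j
    have h2 := congr_arg (algebraMap (𝓞 K) K)
      ((RingOfIntegers.basis K).sum_repr (ϑ ^ (e.symm j : ℕ)))
    rw [map_sum] at h2
    simp only [Matrix.vecMul, dotProduct, Function.comp_apply, pb.basis_eq_pow]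
    refine Eq.trans (Finset.sum_congr rfl fun i _ ↦ ?_) (h2.trans (map_pow _ _ _))
    simp [P, mul_comm]
  have h3 := Algebra.discr_of_matrix_vecMul (integralBasis K) (P.map (Int.cast : ℤ → ℚ))
  have h4 : Algebra.discr ℚ (pb.basis ∘ e.symm) = Algebra.discr ℚ pb.basis :=
    Algebra.discr_reindex _ _ _
  have h5 := pb.abs_discr_eq_of_pow ha
  have hdet : (P.map (Int.cast : ℤ → ℚ)).det = P.det := (Int.cast_det P).symm
  rw [h1, h4, ← coe_discr, hdet] at h3
  rw [h3] at h5
  have h6 : ((P.det ^ 2 * discr K).natAbs : ℤ) = (pb.dim ^ pb.dim * a ^ (pb.dim - 1) : ℕ) := by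
    rw [Int.natCast_natAbs]
    exact_mod_cast h5
  rw [← Int.natCast_inj.mp h6, Int.natAbs_mul]
  refine Nat.le_mul_of_pos_left _ (Int.natAbs_pos.mpr ?_)
  intro h0
  rw [pow_eq_zero_iff two_ne_zero |>.mp h0] at h5
  have := pb.dim_pos
  have h7 : (0 : ℚ) < pb.dim ^ pb.dim * a ^ (pb.dim - 1) := by positivity
  rw [← h5] at h7
  simp at h7
end Discriminant

section PureField
variable {K : Type*} [Field K] [NumberField K]

open Ideal

/-- The first of two complementary divisors of `p`, when `ϑ ^ d ≡ t ^ d` modulo `p`. -/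
noncomputable def rootIdeal (ϑ : 𝓞 K) (p t : ℕ) : Ideal (𝓞 K) :=
  span {(p : 𝓞 K), ϑ - t}

/-- The second of two complementary divisors of `p`, when `ϑ ^ d ≡ t ^ d` modulo `p`. -/
noncomputable def corootIdeal (ϑ : 𝓞 K) (d p t : ℕ) : Ideal (𝓞 K) :=
  span {(p : 𝓞 K), ∑ k ∈ Finset.range d, ϑ ^ k * (t : 𝓞 K) ^ (d - 1 - k)}

theorem isCoprime_of_natCast_mem {R : Type*} [CommRing R] {I J : Ideal R} {m n : ℕ}
    (hmn : m.Coprime n) (hm : (m : R) ∈ I) (hn : (n : R) ∈ J) : IsCoprime I J := by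
  rw [Ideal.isCoprime_iff_exists]
  obtain ⟨u, v, h⟩ := Nat.isCoprime_iff_coprime.mpr hmn
  refine ⟨u * m, I.mul_mem_left _ hm, v * n, J.mul_mem_left _ hn, ?_⟩
  exact_mod_cast congr_arg (Int.cast : ℤ → R) h

theorem natCast_mem_rootIdeal {K : Type*} [Field K] (ϑ : 𝓞 K) (p t : ℕ) : (p : 𝓞 K) ∈ rootIdeal ϑ p t :=
  subset_span (by simp)

theorem isCoprime_rootIdeal_corootIdeal {d p t : ℕ} (ϑ : 𝓞 K) (h : p.Coprime (d * t ^ (d - 1))) :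
    IsCoprime (rootIdeal ϑ p t) (corootIdeal ϑ d p t) := by
  set g := ∑ k ∈ Finset.range d, ϑ ^ k * (t : 𝓞 K) ^ (d - 1 - k) with hg
  have h1 : ϑ - t ∣ g - (d * t ^ (d - 1) : ℕ) := by
    have h2 : ((d * t ^ (d - 1) : ℕ) : 𝓞 K) =
        ∑ k ∈ Finset.range d, (t : 𝓞 K) ^ k * (t : 𝓞 K) ^ (d - 1 - k) := by
      rw [Finset.sum_congr rfl fun k hk ↦ by
        rw [← pow_add, Nat.add_sub_cancel' (by have := Finset.mem_range.mp hk; lia)]]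
      simp
    rw [h2, hg, ← Finset.sum_sub_distrib]
    refine Finset.dvd_sum fun k _ ↦ ?_
    rw [← sub_mul]
    exact (sub_dvd_pow_sub_pow _ _ k).mul_right _
  obtain ⟨y, hy⟩ := h1
  rw [Ideal.isCoprime_iff_exists]
  obtain ⟨u, v, huv⟩ := Nat.isCoprime_iff_coprime.mpr h
  have huv' : (u : 𝓞 K) * p + v * (d * t ^ (d - 1) : ℕ) = 1 := by
    exact_mod_cast congr_arg (Int.cast : ℤ → 𝓞 K) huv
  refine ⟨u * p - v * ((ϑ - t) * y), ?_, v * g, ?_, ?_⟩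
  · exact sub_mem (mul_mem_left _ _ (subset_span (by simp)))
      (mul_mem_left _ _ (mul_mem_right _ _ (subset_span (by simp))))
  · exact mul_mem_left _ _ (subset_span (by simp [hg]))
  · rw [← hy, ← huv']
    ring

theorem rootIdeal_mul_corootIdeal {d a p t : ℕ} {ϑ : 𝓞 K} (hϑ : ϑ ^ d = a)
    (ht : (p : ℤ) ∣ t ^ d - a) (h : p.Coprime (d * t ^ (d - 1))) :
    rootIdeal ϑ p t * corootIdeal ϑ d p t = span {(p : 𝓞 K)} := by
  refine le_antisymm ?_ ?_
  · rw [rootIdeal, corootIdeal, Ideal.span_mul_span', Ideal.span_le]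
    have h1 : (∑ k ∈ Finset.range d, ϑ ^ k * (t : 𝓞 K) ^ (d - 1 - k)) * (ϑ - t) = a - t ^ d := by
      rw [geom_sum₂_mul, hϑ]
    have h2 : (p : 𝓞 K) ∣ a - t ^ d := by
      rw [← dvd_neg, neg_sub]
      simpa using map_dvd (Int.castRingHom (𝓞 K)) ht
    rintro _ ⟨x, hx, y, hy, rfl⟩
    simp only [Set.mem_insert_iff, Set.mem_singleton_iff] at hx hy
    simp only [SetLike.mem_coe, mem_span_singleton]
    rcases hx with rfl | rfl
    · exact dvd_mul_right _ _
    · rcases hy with rfl | rfl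
      · exact dvd_mul_left _ _
      · rw [mul_comm, h1]
        exact h2
  · calc span {(p : 𝓞 K)} = span {(p : 𝓞 K)} * (rootIdeal ϑ p t ⊔ corootIdeal ϑ d p t) := by
          rw [Ideal.isCoprime_iff_sup_eq.mp (isCoprime_rootIdeal_corootIdeal ϑ h), Ideal.mul_top]
      _ = span {(p : 𝓞 K)} * rootIdeal ϑ p t ⊔ span {(p : 𝓞 K)} * corootIdeal ϑ d p t :=
          Ideal.mul_sup _ _ _
      _ ≤ _ := by
          refine sup_le ?_ ?_
          · rw [mul_comm]
            refine mul_mono_right ((span_singleton_le_iff_mem _).mpr (subset_span (by simp)))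
          · refine mul_mono_left ((span_singleton_le_iff_mem _).mpr (subset_span (by simp)))

theorem rootIdeal_ne_top {a p t : ℕ} {ϑ : 𝓞 K} (pb : PowerBasis ℚ K) (hgen : pb.gen = ϑ)
    (hϑ : ϑ ^ pb.dim = a) (ht : (p : ℤ) ∣ t ^ pb.dim - a)
    (h : p.Coprime (pb.dim * t ^ (pb.dim - 1))) (hp : p ≠ 1) : rootIdeal ϑ p t ≠ ⊤ := by
  intro htop
  have h1 := rootIdeal_mul_corootIdeal hϑ ht h
  rw [htop, Ideal.top_mul] at h1
  have h2 : ∑ k ∈ Finset.range pb.dim, ϑ ^ k * (t : 𝓞 K) ^ (pb.dim - 1 - k) ∈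
      corootIdeal ϑ pb.dim p t := subset_span (by simp)
  rw [h1, mem_span_singleton] at h2
  obtain ⟨y, hy⟩ := h2
  have ha : pb.gen ^ pb.dim = algebraMap ℚ K a := by
    rw [hgen, map_natCast]
    exact_mod_cast congr_arg (algebraMap (𝓞 K) K) hϑ
  have h3 : Algebra.trace ℚ K (∑ k ∈ Finset.range pb.dim, pb.gen ^ k * (t : K) ^ (pb.dim - 1 - k)) =
      pb.dim * t ^ (pb.dim - 1) := by
    rw [map_sum, Finset.sum_eq_single_of_mem 0 (Finset.mem_range.mpr pb.dim_pos)]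
    · rw [pow_zero, one_mul, Nat.sub_zero, ← Nat.cast_pow, ← map_natCast (algebraMap ℚ K),
        pb.trace_algebraMap_dim, Nat.cast_pow]
    · intro k hk hk0
      have := Finset.mem_range.mp hk
      rw [← Nat.cast_pow, ← map_natCast (algebraMap ℚ K), mul_comm, ← Algebra.smul_def, map_smul,
        pb.trace_gen_pow_eq_zero ha (Nat.not_dvd_of_pos_of_lt (Nat.pos_of_ne_zero hk0) this),
        smul_zero]
  have h4 : ((p * Algebra.trace ℤ (𝓞 K) y : ℤ) : ℚ) = (pb.dim * t ^ (pb.dim - 1) : ℕ) := by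
    have h5 := congr_arg (algebraMap (𝓞 K) K) hy
    rw [map_sum, map_mul] at h5
    simp only [map_mul, map_pow, map_natCast] at h5
    rw [hgen] at h3
    push_cast
    rw [← h3, Algebra.coe_trace_int, ← nsmul_eq_mul, ← map_nsmul, nsmul_eq_mul]
    exact congr_arg _ h5.symm
  have h5 : (p : ℤ) ∣ (pb.dim * t ^ (pb.dim - 1) : ℕ) := ⟨_, by exact_mod_cast h4.symm⟩
  exact hp (Nat.Coprime.eq_one_of_dvd h (Int.natCast_dvd_natCast.mp h5))

theorem trace_mul_ne_zero {a p t : ℕ} {ϑ β : 𝓞 K} (pb : PowerBasis ℚ K) (hgen : pb.gen = ϑ)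
    (hϑ : ϑ ^ pb.dim = a) (hpt : p.Coprime t) (hpa : p.Coprime (pb.dim * a))
    (hβ : (p : 𝓞 K) ∣ β * (ϑ - t)) (hpβ : ¬ (p : 𝓞 K) ∣ β) :
    Algebra.trace ℤ (𝓞 K) (β * ϑ) ≠ 0 := by
  intro h0
  have ha : pb.gen ^ pb.dim = algebraMap ℚ K a := by
    rw [hgen, map_natCast]
    exact_mod_cast congr_arg (algebraMap (𝓞 K) K) hϑ
  have hdvd {x : 𝓞 K} (hx : (p : 𝓞 K) ∣ x) : (p : ℤ) ∣ Algebra.trace ℤ (𝓞 K) x := by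
    obtain ⟨y, rfl⟩ := hx
    rw [← nsmul_eq_mul, map_nsmul, nsmul_eq_mul]
    exact dvd_mul_right _ _
  have hpow (k : ℕ) : (p : ℤ) ∣ Algebra.trace ℤ (𝓞 K) (β * ϑ ^ k) -
      t ^ k * Algebra.trace ℤ (𝓞 K) β := by
    have h1 : (p : 𝓞 K) ∣ β * ϑ ^ k - (t ^ k : ℕ) * β := by
      rw [mul_comm _ β, ← mul_sub]
      push_cast
      obtain ⟨y, hy⟩ := sub_dvd_pow_sub_pow ϑ (t : 𝓞 K) k
      rw [hy, ← mul_assoc]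
      exact hβ.mul_right _
    have h2 := hdvd h1
    rw [map_sub, ← nsmul_eq_mul, map_nsmul, nsmul_eq_mul] at h2
    exact_mod_cast h2
  have htr : (p : ℤ) ∣ Algebra.trace ℤ (𝓞 K) β := by
    have h1 := hpow 1
    rw [pow_one, pow_one, h0, zero_sub, dvd_neg] at h1
    exact IsCoprime.dvd_of_dvd_mul_left (Nat.isCoprime_iff_coprime.mpr hpt) h1
  have hall (k : ℕ) : (p : ℤ) ∣ Algebra.trace ℤ (𝓞 K) (β * ϑ ^ k) :=
    (dvd_sub_left (htr.mul_left _)).mp (hpow k)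
  have hexp : ((pb.dim * a : ℕ) : 𝓞 K) * β = ∑ k ∈ Finset.range pb.dim,
      (Algebra.trace ℤ (𝓞 K) (β * ϑ ^ (pb.dim - k)) : 𝓞 K) * ϑ ^ k := by
    apply RingOfIntegers.ext
    change algebraMap (𝓞 K) K _ = algebraMap (𝓞 K) K _
    have h1 := pb.mul_eq_sum_trace_mul ha (β : K)
    rw [map_sum]
    simp only [map_mul, map_pow, map_natCast, map_intCast, Nat.cast_mul, ← hgen]
    simp only [map_mul, map_natCast] at h1
    rw [h1]
    refine Finset.sum_congr rfl fun k _ ↦ ?_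
    congr 1
    rw [← map_intCast (algebraMap ℚ K), Algebra.coe_trace_int, hgen]
    push_cast
    rfl
  have h1 : (p : 𝓞 K) ∣ ((pb.dim * a : ℕ) : 𝓞 K) * β := by
    rw [hexp]
    refine Finset.dvd_sum fun k _ ↦ Dvd.dvd.mul_right ?_ _
    simpa using map_dvd (Int.castRingHom (𝓞 K)) (hall (pb.dim - k))
  refine hpβ (IsCoprime.dvd_of_dvd_mul_left ?_ h1)
  have h2 := (Nat.isCoprime_iff_coprime.mpr hpa).map (Int.castRingHom (𝓞 K))
  rwa [map_natCast, map_natCast] at h2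

theorem absNorm_rootIdeal_le {d a p t : ℕ} {ϑ : 𝓞 K} (hϑ : ϑ ^ d = a)
    (ht : (p : ℤ) ∣ t ^ d - a) (h : p.Coprime (d * t ^ (d - 1))) (hp : p ≠ 0) :
    rootIdeal ϑ p t ≠ ⊥ ∧ absNorm (rootIdeal ϑ p t) ≤ p ^ Module.finrank ℚ K := by
  have h1 : absNorm (span {(p : 𝓞 K)}) = p ^ Module.finrank ℚ K := by
    rw [absNorm_span_singleton, ← map_natCast (algebraMap ℤ (𝓞 K)), Algebra.norm_algebraMap,
      RingOfIntegers.rank]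
    simp [Int.natAbs_pow]
  constructor
  · intro h0
    have := natCast_mem_rootIdeal ϑ p t
    rw [h0, Ideal.mem_bot] at this
    exact hp (by exact_mod_cast this)
  · refine Nat.le_of_dvd (by positivity) ?_
    rw [← h1, ← rootIdeal_mul_corootIdeal hϑ ht h, map_mul]
    exact dvd_mul_right _ _
end PureField

section Separation
variable {K : Type*} [Field K] [NumberField K]

open Ideal

theorem abs_trace_le {x : 𝓞 K} {B : ℝ} (hB : ∀ v : InfinitePlace K, v x ≤ B) :
    |(Algebra.trace ℤ (𝓞 K) x : ℝ)| ≤ Module.finrank ℚ K * B := by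
  have h1 : ((Algebra.trace ℤ (𝓞 K) x : ℝ) : ℂ) = ∑ σ : K →ₐ[ℚ] ℂ, σ x := by
    rw [← trace_eq_sum_embeddings, ← Algebra.coe_trace_int]
    simp
  have h2 : |(Algebra.trace ℤ (𝓞 K) x : ℝ)| = ‖∑ σ : K →ₐ[ℚ] ℂ, σ x‖ := by
    rw [← h1, Complex.norm_real, Real.norm_eq_abs]
  rw [h2, ← AlgHom.card ℚ K ℂ, ← nsmul_eq_mul]
  exact (norm_sum_le _ _).trans
    (Finset.sum_le_card_nsmul _ _ _ fun σ _ ↦ hB (InfinitePlace.mk σ.toRingHom))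

theorem infinitePlace_eq_rpow {K : Type*} [Field K] {ϑ : 𝓞 K} {d a : ℕ} (hd : d ≠ 0) (hϑ : ϑ ^ d = a)
    (v : InfinitePlace K) : v ϑ = (a : ℝ) ^ (1 / d : ℝ) := by
  have h1 : v ϑ ^ d = a := by
    rw [← map_pow, ← InfinitePlace.norm_embedding_eq]
    have : (ϑ : K) ^ d = a := by exact_mod_cast congr_arg (algebraMap (𝓞 K) K) hϑ
    rw [this]
    simp
  rw [← h1, ← Real.rpow_natCast, ← Real.rpow_mul (apply_nonneg v _),
    mul_one_div_cancel (by exact_mod_cast hd), Real.rpow_one]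

theorem exists_trace_mul_ne_zero {a p p' t t' ℓ : ℕ} {ϑ u w : 𝓞 K} (pb : PowerBasis ℚ K)
    (hgen : pb.gen = ϑ) (hϑ : ϑ ^ pb.dim = a) (hpt : p.Coprime t)
    (hpa : p.Coprime (pb.dim * a)) (hp1 : p ≠ 1) (ht : (p : ℤ) ∣ t ^ pb.dim - a)
    (hpp : p.Coprime p') (hℓ : ℓ ≠ 0) (hw : w ≠ 0)
    (huw : span {u} * rootIdeal ϑ p t ^ ℓ = span {w} * rootIdeal ϑ p' t' ^ ℓ) :
    ∃ β : 𝓞 K, w * β = u * (p : 𝓞 K) ^ ℓ ∧ Algebra.trace ℤ (𝓞 K) (β * ϑ) ≠ 0 := by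
  have h : p.Coprime (pb.dim * t ^ (pb.dim - 1)) :=
    (Nat.Coprime.coprime_mul_right_right hpa).mul_right (hpt.pow_right _)
  have hPQ := rootIdeal_mul_corootIdeal hϑ ht h
  have hcop := isCoprime_rootIdeal_corootIdeal ϑ h
  have hcop' : IsCoprime (rootIdeal ϑ p t) (rootIdeal ϑ p' t') :=
    isCoprime_of_natCast_mem hpp (natCast_mem_rootIdeal ϑ p t) (natCast_mem_rootIdeal ϑ p' t')
  have hptop := rootIdeal_ne_top pb hgen hϑ ht h hp1
  have hpP := natCast_mem_rootIdeal ϑ p t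
  have hQ : ∀ β ∈ corootIdeal ϑ pb.dim p t,
      β * (ϑ - t) ∈ corootIdeal ϑ pb.dim p t * rootIdeal ϑ p t :=
    fun β hβ ↦ mul_mem_mul hβ (subset_span (by simp))
  generalize rootIdeal ϑ p t = P at *
  generalize corootIdeal ϑ pb.dim p t = Q at *
  generalize rootIdeal ϑ p' t' = P' at *
  have h1 : span {u * (p : 𝓞 K) ^ ℓ} = span {w} * (P' ^ ℓ * Q ^ ℓ) := by
    rw [← mul_assoc, ← huw, mul_assoc, ← mul_pow, hPQ, span_singleton_pow,
      span_singleton_mul_span_singleton]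
  obtain ⟨β, hβI, hβ⟩ : ∃ β ∈ P' ^ ℓ * Q ^ ℓ, w * β = u * (p : 𝓞 K) ^ ℓ := by
    rw [← mem_span_singleton_mul, ← h1]
    exact mem_span_singleton_self _
  have hβI' : span {β} = P' ^ ℓ * Q ^ ℓ := by
    rw [← hβ, ← span_singleton_mul_span_singleton] at h1
    exact (span_singleton_mul_right_inj hw).mp h1
  have hle : P' ^ ℓ * Q ^ ℓ ≤ Q := Ideal.mul_le_right.trans (Ideal.pow_le_self hℓ)
  have hβQ : β ∈ Q := hle hβI
  have hβ1 : (p : 𝓞 K) ∣ β * (ϑ - t) := by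
    rw [← mem_span_singleton, ← hPQ, mul_comm P Q]
    exact hQ β hβQ
  have hpβ : ¬ (p : 𝓞 K) ∣ β := by
    intro hdvd
    have h2 : P' ^ ℓ * Q ^ ℓ ≤ P := by
      rw [← hβI', span_singleton_le_iff_mem]
      exact P.mem_of_dvd hdvd hpP
    have h3 : IsCoprime P (P' ^ ℓ * Q ^ ℓ) :=
      hcop'.pow_right.mul_right hcop.pow_right
    refine hptop ?_
    rw [← isCoprime_iff_sup_eq.mp h3, sup_eq_left.mpr h2]
  exact ⟨β, hβ, trace_mul_ne_zero pb hgen hϑ hpt hpa hβ1 hpβ⟩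

/-- If the quotient of the `ℓ`-th powers of two distinct degree one prime factors is principal,
then every generator has a large conjugate. -/
theorem le_of_span_mul_rootIdeal_pow_eq {a p p' t t' ℓ : ℕ} {ϑ u w : 𝓞 K} (pb : PowerBasis ℚ K)
    (hgen : pb.gen = ϑ) (hϑ : ϑ ^ pb.dim = a) (ha : Squarefree a)
    (hpt : p.Coprime t) (hpa : p.Coprime (pb.dim * a)) (hp1 : p ≠ 1)
    (ht : (p : ℤ) ∣ t ^ pb.dim - a) (hpp : p.Coprime p') (hℓ : ℓ ≠ 0) (hw : w ≠ 0)
    (huw : span {u} * rootIdeal ϑ p t ^ ℓ = span {w} * rootIdeal ϑ p' t' ^ ℓ)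
    {B : ℝ} (hB : ∀ v : InfinitePlace K, v u ≤ B * v w) :
    (a : ℝ) ≤ pb.dim * (B * p ^ ℓ * (a : ℝ) ^ (1 / pb.dim : ℝ)) := by
  obtain ⟨β, hβ, h0⟩ := exists_trace_mul_ne_zero pb hgen hϑ hpt hpa hp1 ht hpp hℓ hw huw
  have hdvd : (a : ℤ) ∣ Algebra.trace ℤ (𝓞 K) (β * ϑ) := by
    refine dvd_trace_of_dvd_pow (d := pb.dim) ha ?_
    rw [mul_pow, hϑ]
    exact dvd_mul_left _ _
  have h2 : (a : ℝ) ≤ |(Algebra.trace ℤ (𝓞 K) (β * ϑ) : ℝ)| := by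
    exact_mod_cast Int.le_of_dvd (abs_pos.mpr h0) ((dvd_abs _ _).mpr hdvd)
  refine h2.trans ((abs_trace_le (B := B * p ^ ℓ * (a : ℝ) ^ (1 / pb.dim : ℝ)) fun v ↦ ?_).trans_eq
    (by rw [pb.finrank]))
  have hv : 0 < v w := v.pos_iff.mpr (by exact_mod_cast hw)
  have hvβ : v β ≤ B * p ^ ℓ := by
    have h3 : v w * v β = v u * (p : ℝ) ^ ℓ := by
      have h4 : (w : K) * β = u * (p : K) ^ ℓ := by
        exact_mod_cast congr_arg (algebraMap (𝓞 K) K) hβ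
      rw [← map_mul, h4, map_mul, map_pow, ← InfinitePlace.norm_embedding_eq v (p : K)]
      simp
    have h5 := mul_le_mul_of_nonneg_right (hB v) (pow_nonneg (Nat.cast_nonneg (α := ℝ) p) ℓ)
    nlinarith
  rw [← infinitePlace_eq_rpow pb.dim_pos.ne' hϑ v]
  push_cast
  rw [map_mul]
  exact mul_le_mul_of_nonneg_right hvβ (apply_nonneg v _)
end Separation

section RootsModPrime

theorem exists_prime_dvd_pow_sub {p d a : ℕ} (hp : p.Prime) (hpd : (p - 1).Coprime d)
    (hpa : p.Coprime a) : ∃ t : ℕ, p.Coprime t ∧ (p : ℤ) ∣ t ^ d - a := by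
  have : Fact p.Prime := ⟨hp⟩
  have hcard : (Nat.card (ZMod p)ˣ).Coprime d := by
    rwa [Nat.card_eq_fintype_card, ZMod.card_units p]
  obtain ⟨x, hx⟩ := (powCoprime hcard).surjective (ZMod.unitOfCoprime a hpa.symm)
  refine ⟨(x : ZMod p).val, (ZMod.val_coe_unit_coprime x).symm, ?_⟩
  rw [← ZMod.intCast_zmod_eq_zero_iff_dvd _ p]
  have hx' := congr_arg (Units.val) hx
  simp only [powCoprime_apply, Units.val_pow_eq_pow_val, ZMod.coe_unitOfCoprime] at hx'
  simp [hx']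

theorem coprime_of_natCast_eq_two {p d : ℕ} (hp : p.Prime) (hd : Odd d) (h : (p : ZMod d) = 2) :
    p.Coprime d ∧ (p - 1).Coprime d := by
  have h1 : ((p - 1 : ℕ) : ZMod d) = 1 := by
    rw [Nat.cast_sub hp.one_le, h]
    norm_num
  constructor
  · rw [← ZMod.isUnit_iff_coprime, h]
    exact_mod_cast (ZMod.isUnit_iff_coprime 2 d).mpr (Nat.coprime_two_left.mpr hd)
  · rw [← ZMod.isUnit_iff_coprime, h1]
    exact isUnit_one

theorem card_primeFactors_le_log {a : ℕ} (ha : a ≠ 0) : a.primeFactors.card ≤ Nat.log 2 a := by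
  refine Nat.le_log_of_pow_le one_lt_two ?_
  calc 2 ^ a.primeFactors.card ≤ ∏ p ∈ a.primeFactors, p :=
        Finset.pow_card_le_prod _ _ _
          fun p hp ↦ (Nat.prime_of_mem_primeFactors hp).two_le
    _ ≤ a := Nat.le_of_dvd (Nat.pos_of_ne_zero ha) (Nat.prod_primeFactors_dvd a)

end RootsModPrime

section PureFieldTorsion
variable {K : Type*} [Field K] [NumberField K]

open Ideal Module

theorem card_torsion_le_of_discr_le {ℓ D : ℕ} (hℓ : 0 < ℓ) (hD : (discr K).natAbs ≤ D) :
    (Nat.card {c : ClassGroup (𝓞 K) // c ^ ℓ = 1} : ℝ) ≤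
      (2 * (2 ^ finrank ℚ K * √D)) ^ (2 : ℝ) * (∑' n : ℕ, 1 / (n : ℝ) ^ (2 : ℝ)) ^ finrank ℚ K *
        (2 * (ℓ * Real.log (2 * (2 ^ finrank ℚ K * √D))) + 2) ^ finrank ℚ K := by
  have hD' : |(discr K : ℝ)| ≤ D := by
    rw [← Int.cast_abs, Int.abs_eq_natAbs]
    exact_mod_cast hD
  have h1 : (1 : ℝ) ≤ |(discr K : ℝ)| := by
    exact_mod_cast Int.one_le_abs (discr_ne_zero K)
  have h2 : (1 : ℝ) ≤ √|(discr K : ℝ)| := Real.one_le_sqrt.mpr h1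
  have h3 : (1 : ℝ) ≤ 2 ^ finrank ℚ K := one_le_pow₀ one_le_two
  have h4 : (1 : ℝ) ≤ 2 * (2 ^ finrank ℚ K * √|(discr K : ℝ)|) := by nlinarith
  have h5 := card_torsion_mul_card_le (K := K) hℓ (Finset.univ : Finset Unit) (P := fun _ ↦ ⊤)
    (fun _ _ ↦ top_ne_bot) rfl le_rfl (by simp) (by simp) one_lt_two
  rw [mul_one, Finset.card_univ, Fintype.card_unit, Nat.cast_one, mul_one] at h5
  refine h5.trans ?_
  have h6 := Real.log_nonneg h4
  gcongr

theorem exists_powerBasis_gen_eq {θ : K} (htop : IntermediateField.adjoin ℚ {θ} = ⊤) :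
    ∃ pb : PowerBasis ℚ K, pb.gen = θ ∧ pb.dim = finrank ℚ K := by
  have hinteg : IsIntegral ℚ θ := .of_finite ℚ θ
  have htop' : Algebra.adjoin ℚ {θ} = ⊤ := by
    rw [← IntermediateField.adjoin_simple_toSubalgebra_of_isAlgebraic hinteg.isAlgebraic, htop]
    rfl
  exact ⟨PowerBasis.ofAdjoinEqTop' hinteg htop', PowerBasis.ofAdjoinEqTop'_gen hinteg htop',
    (PowerBasis.finrank _).symm⟩

theorem natAbs_discr_le_of_pow {d a : ℕ} {θ : K} (ha : Squarefree a) (hθ : θ ^ d = a)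
    (htop : IntermediateField.adjoin ℚ {θ} = ⊤) (hd : finrank ℚ K = d) :
    (discr K).natAbs ≤ d ^ d * a ^ (d - 1) := by
  obtain ⟨pb, hgen, hdim⟩ := exists_powerBasis_gen_eq htop
  rw [hd] at hdim
  have h := pb.natAbs_discr_le_of_pow (Nat.pos_of_ne_zero ha.ne_zero) (by rw [hgen, hdim, hθ])
  rwa [hdim] at h

theorem card_torsion_mul_card_primes_le {d ℓ a : ℕ} {θ : K} (hodd : Odd d) (hℓ : 0 < ℓ)
    (ha : Squarefree a) (hθ : θ ^ d = a)
    (htop : IntermediateField.adjoin ℚ {θ} = ⊤) (hd : finrank ℚ K = d) {x : ℝ} (hx : 1 ≤ x)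
    (hxa : d * (Real.exp 1 * x ^ ℓ * (a : ℝ) ^ (1 / d : ℝ)) < a) {s : ℝ} (hs : 1 < s) :
    (Nat.card {c : ClassGroup (𝓞 K) // c ^ ℓ = 1} : ℝ) *
      (((Finset.Icc 1 ⌊x⌋₊).filter fun p : ℕ ↦ p.Prime ∧ (p : ZMod d) = 2).card - Nat.log 2 a) ≤
      (2 * (2 ^ d * √|(discr K : ℝ)|)) ^ s * (∑' n : ℕ, 1 / (n : ℝ) ^ s) ^ d *
        (2 * (ℓ * Real.log (2 * (2 ^ d * √|(discr K : ℝ)|) * x ^ d)) + 2) ^ d := by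
  classical
  obtain ⟨pb, hgen, hdim⟩ := exists_powerBasis_gen_eq htop
  rw [hd] at hdim
  have hd0 : 0 < d := hdim ▸ pb.dim_pos
  have hϑint : IsIntegral ℤ θ := by
    refine IsIntegral.of_pow hd0 ?_
    rw [hθ]
    simpa using (isIntegral_algebraMap : IsIntegral ℤ (algebraMap ℤ K a))
  obtain ⟨ϑ, rfl⟩ : ∃ ϑ : 𝓞 K, (ϑ : K) = θ := ⟨⟨θ, hϑint⟩, rfl⟩
  have hϑ : ϑ ^ d = a := by
    apply RingOfIntegers.ext
    exact_mod_cast hθ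
  set S' := (Finset.Icc 1 ⌊x⌋₊).filter fun p : ℕ ↦ p.Prime ∧ (p : ZMod d) = 2 with hS'
  set S := S'.filter fun p ↦ ¬ p ∣ a with hS
  have hcard : (S'.card : ℝ) - Nat.log 2 a ≤ S.card := by
    have h1 : (S'.filter fun p ↦ p ∣ a).card ≤ Nat.log 2 a := by
      refine (Finset.card_le_card fun p hp ↦ ?_).trans (card_primeFactors_le_log ha.ne_zero)
      simp only [hS', Finset.mem_filter] at hp
      exact Nat.mem_primeFactors.mpr ⟨hp.1.2.1, hp.2, ha.ne_zero⟩
    have h2 := S'.card_filter_add_card_filter_not fun p ↦ p ∣ a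
    rw [sub_le_iff_le_add]
    exact_mod_cast (by lia : S'.card ≤ S.card + Nat.log 2 a)
  have hmem {p : ℕ} (hp : p ∈ S) : p.Prime ∧ (p : ℝ) ≤ x ∧ p.Coprime d ∧ (p - 1).Coprime d ∧
      p.Coprime a := by
    simp only [hS, hS', Finset.mem_filter, Finset.mem_Icc] at hp
    obtain ⟨⟨⟨-, h1⟩, h2, h3⟩, h4⟩ := hp
    obtain ⟨h5, h6⟩ := coprime_of_natCast_eq_two h2 hodd h3
    exact ⟨h2, (Nat.le_floor_iff (by linarith)).mp h1, h5, h6,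
      (Nat.Prime.coprime_iff_not_dvd h2).mpr h4⟩
  have ht (p : ℕ) : ∃ t : ℕ, p ∈ S → p.Coprime t ∧ (p : ℤ) ∣ t ^ d - a := by
    by_cases hp : p ∈ S
    · obtain ⟨h1, -, -, h4, h5⟩ := hmem hp
      obtain ⟨t, ht⟩ := exists_prime_dvd_pow_sub h1 h4 h5
      exact ⟨t, fun _ ↦ ht⟩
    · exact ⟨0, fun h ↦ absurd h hp⟩
  choose t ht using ht
  have hcop {p : ℕ} (hp : p ∈ S) : p.Coprime (d * t p ^ (d - 1)) :=
    (hmem hp).2.2.1.mul_right ((ht p hp).1.pow_right _)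
  have hnorm {p : ℕ} (hp : p ∈ S) := absNorm_rootIdeal_le hϑ (ht p hp).2 (hcop hp)
    (hmem hp).1.ne_zero
  have key := card_torsion_mul_card_le (K := K) hℓ S (P := fun p ↦ rootIdeal ϑ p (t p))
    (fun p hp ↦ (hnorm hp).1) rfl (one_le_pow₀ hx : 1 ≤ x ^ finrank ℚ K) (fun p hp ↦ ?_)
    (fun p hp p' hp' u w _ hw huw huw' ↦ ?_) hs
  · rw [hd] at key
    exact (mul_le_mul_of_nonneg_left hcard (Nat.cast_nonneg _)).trans key
  · calc (absNorm (rootIdeal ϑ p (t p)) : ℝ) ≤ (p : ℝ) ^ finrank ℚ K := by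
          exact_mod_cast (hnorm hp).2
      _ ≤ x ^ finrank ℚ K := by
          have := (hmem hp).2.1
          gcongr
  · by_contra hne
    obtain ⟨h1, h2, h3, -, h5⟩ := hmem hp
    have h6 := le_of_span_mul_rootIdeal_pow_eq pb hgen (hdim ▸ hϑ) ha (ht p hp).1
      (hdim ▸ h3.mul_right h5) h1.ne_one (hdim ▸ (ht p hp).2)
      ((Nat.coprime_primes h1 (hmem hp').1).mpr hne) hℓ.ne' hw huw huw'
    rw [hdim] at h6
    refine absurd (h6.trans ?_) hxa.not_ge
    gcongr
end PureFieldTorsion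

section Asymptotics

open Filter Topology Asymptotics

/-- The range of primes in which the prime ideals chosen above a squarefree `a` are separated. -/
noncomputable def primeRange (d ℓ a : ℕ) : ℝ :=
  ((a : ℝ) ^ (1 - 1 / d : ℝ) / (2 * d * Real.exp 1)) ^ (1 / ℓ : ℝ)

theorem primeRange_eq (d ℓ a : ℕ) : primeRange d ℓ a =
    (2 * d * Real.exp 1) ^ (-(1 / ℓ) : ℝ) * (a : ℝ) ^ ((1 - 1 / d) / ℓ : ℝ) := by
  rw [primeRange, Real.div_rpow (by positivity) (by positivity), ← Real.rpow_mul (by positivity),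
    Real.rpow_neg (by positivity), div_eq_inv_mul, mul_one_div]

theorem mul_primeRange_pow_lt {d ℓ a : ℕ} (hd : 0 < d) (hℓ : 0 < ℓ) (ha : 0 < a) :
    d * (Real.exp 1 * primeRange d ℓ a ^ ℓ * (a : ℝ) ^ (1 / d : ℝ)) < a := by
  have ha' : (0 : ℝ) < a := by exact_mod_cast ha
  have hd' : (0 : ℝ) < d := by exact_mod_cast hd
  rw [primeRange, ← Real.rpow_natCast (_ ^ _) ℓ, ← Real.rpow_mul (by positivity),
    one_div_mul_cancel (by positivity), Real.rpow_one, Real.rpow_sub ha', Real.rpow_one]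
  have := Real.rpow_pos_of_pos ha' (1 / d : ℝ)
  have he := Real.exp_pos 1
  field_simp
  norm_num

theorem tendsto_primeRange {d ℓ : ℕ} (hd : 2 ≤ d) (hℓ : 0 < ℓ) :
    Tendsto (fun a : ℕ ↦ primeRange d ℓ a) atTop atTop := by
  have hd' : (2 : ℝ) ≤ d := by exact_mod_cast hd
  have hℓ' : (0 : ℝ) < ℓ := by exact_mod_cast hℓ
  simp only [primeRange_eq]
  refine Tendsto.const_mul_atTop (by positivity)
    ((tendsto_rpow_atTop ?_).comp tendsto_natCast_atTop_atTop)
  have : (1 : ℝ) / d < 1 := by rw [div_lt_one (by linarith)]; linarith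
  exact div_pos (by linarith) hℓ'

theorem isLittleO_add_mul_log_rpow (A B : ℝ) {η : ℝ} (hη : 0 < η) :
    (fun x : ℝ ↦ A + B * Real.log x) =o[atTop] fun x ↦ x ^ η := by
  refine IsLittleO.add ?_ ((isLittleO_log_rpow_atTop hη).const_mul_left B)
  exact isLittleO_const_left.mpr (Or.inr
    ((tendsto_norm_atTop_atTop).comp (tendsto_rpow_atTop hη)))

theorem eventually_add_mul_log_le (A B : ℝ) {c η : ℝ} (hc : 0 < c) (hη : 0 < η) :
    ∀ᶠ a : ℕ in atTop, A + B * Real.log a ≤ c * (a : ℝ) ^ η := by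
  have h := ((isLittleO_add_mul_log_rpow A B hη).bound hc).filter_mono
    (tendsto_natCast_atTop_atTop (R := ℝ))
  filter_upwards [h] with a ha
  refine (Real.le_norm_self _).trans (ha.trans_eq ?_)
  rw [Real.norm_of_nonneg (by positivity)]

theorem primeRange_le {d ℓ a : ℕ} (hd : 0 < d) (hℓ : 0 < ℓ) (ha : 1 ≤ a) :
    primeRange d ℓ a ≤ a := by
  have ha' : (1 : ℝ) ≤ a := by exact_mod_cast ha
  have hd' : (1 : ℝ) ≤ d := by exact_mod_cast hd
  have hℓ' : (1 : ℝ) ≤ ℓ := by exact_mod_cast hℓ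
  have he : (1 : ℝ) ≤ Real.exp 1 := Real.one_le_exp zero_le_one
  rw [primeRange_eq]
  have h1 : (2 * d * Real.exp 1) ^ (-(1 / ℓ) : ℝ) ≤ 1 :=
    Real.rpow_le_one_of_one_le_of_nonpos (by nlinarith) (by simp)
  have h2 : (a : ℝ) ^ ((1 - 1 / d) / ℓ : ℝ) ≤ a := by
    conv_rhs => rw [← Real.rpow_one (a : ℝ)]
    refine Real.rpow_le_rpow_of_exponent_le ha' ?_
    rw [div_le_one (by linarith)]
    have : (0 : ℝ) ≤ 1 / d := by positivity
    linarith
  calc _ ≤ 1 * (a : ℝ) := by gcongr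
    _ = a := one_mul _

theorem exists_eventually_le_card_primes {d ℓ : ℕ} (hd : 2 ≤ d) (hodd : Odd d) (hℓ : 0 < ℓ)
    {δ : ℝ} (hδ : 0 < δ) (hδ1 : δ < 1) :
    ∃ c : ℝ, 0 < c ∧ ∀ᶠ a : ℕ in atTop, c * (a : ℝ) ^ ((1 - 1 / d) / ℓ * (1 - δ) : ℝ) ≤
      ((Finset.Icc 1 ⌊primeRange d ℓ a⌋₊).filter
        fun p : ℕ ↦ p.Prime ∧ (p : ZMod d) = 2).card - Nat.log 2 a := by
  have : NeZero d := ⟨by lia⟩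
  have hu : IsUnit (2 : ZMod d) := by
    exact_mod_cast (ZMod.isUnit_iff_coprime 2 d).mpr (Nat.coprime_two_left.mpr hodd)
  obtain ⟨c, hc, h⟩ := exists_mul_rpow_le_card_primes hu hδ hδ1
  have hd' : (2 : ℝ) ≤ d := by exact_mod_cast hd
  have hℓ' : (0 : ℝ) < ℓ := by exact_mod_cast hℓ
  set κ : ℝ := (1 - 1 / d) / ℓ * (1 - δ) with hκ
  have hκ0 : 0 < κ := by
    have : (1 : ℝ) / d < 1 := by rw [div_lt_one (by linarith)]; linarith
    exact mul_pos (div_pos (by linarith) hℓ') (by linarith)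
  set c₀ : ℝ := ((2 * d * Real.exp 1) ^ (-(1 / ℓ) : ℝ)) ^ (1 - δ) with hc₀
  have hc₀0 : 0 < c₀ := by positivity
  refine ⟨c * c₀ / 2, by positivity, ?_⟩
  filter_upwards [(tendsto_primeRange hd hℓ).eventually h,
    eventually_add_mul_log_le 0 (Real.log 2)⁻¹ (by positivity : 0 < c * c₀ / 2) hκ0,
    eventually_ge_atTop 1] with a h1 h2 h3
  have h4 : (Nat.log 2 a : ℝ) ≤ (Real.log 2)⁻¹ * Real.log a := by
    rw [← div_eq_inv_mul, Real.log_div_log]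
    exact Real.natLog_le_logb a 2
  have h5 : primeRange d ℓ a ^ (1 - δ) = c₀ * (a : ℝ) ^ κ := by
    rw [primeRange_eq, Real.mul_rpow (by positivity) (by positivity),
      ← Real.rpow_mul (by positivity : (0 : ℝ) ≤ a)]
  rw [h5] at h1
  linarith

theorem eventually_log_pow_le (d ℓ : ℕ) (hd : 0 < d) {B : ℝ} (hB : 1 ≤ B) {δ : ℝ} (hδ : 0 < δ) :
    ∀ᶠ a : ℕ in atTop, (2 * (ℓ * Real.log (B * (a : ℝ) ^ (2 * d))) + 2) ^ d ≤ (a : ℝ) ^ δ := by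
  have hd' : (0 : ℝ) < d := by exact_mod_cast hd
  filter_upwards [eventually_add_mul_log_le (2 * ℓ * Real.log B + 2) (2 * ℓ * (2 * d)) one_pos
    (div_pos hδ hd'), eventually_ge_atTop 1] with a h1 h2
  have ha : (1 : ℝ) ≤ a := by exact_mod_cast h2
  have h3 : Real.log (B * (a : ℝ) ^ (2 * d)) = Real.log B + 2 * d * Real.log a := by
    rw [Real.log_mul (by positivity) (by positivity), Real.log_pow]
    push_cast
    rfl
  have h4 := Real.log_nonneg hB
  have h5 := Real.log_nonneg ha
  calc _ ≤ ((a : ℝ) ^ (δ / d)) ^ d := by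
        refine pow_le_pow_left₀ (by rw [h3]; positivity) ?_ d
        rw [h3]
        linarith
    _ = _ := by rw [← Real.rpow_natCast, ← Real.rpow_mul (by positivity),
        div_mul_cancel₀ _ hd'.ne']

theorem rpow_le_of_le_mul_pow {d a D : ℕ} (hd : 2 ≤ d) (hD : D ≤ d ^ d * a ^ (d - 1))
    {τ : ℝ} (hτ : 0 ≤ τ) :
    (D : ℝ) ^ (τ / (d - 1)) ≤ ((d : ℝ) ^ d) ^ (τ / (d - 1)) * (a : ℝ) ^ τ := by
  have hd' : (2 : ℝ) ≤ d := by exact_mod_cast hd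
  have h1 : (D : ℝ) ≤ (d : ℝ) ^ d * (a : ℝ) ^ (d - 1) := by exact_mod_cast hD
  calc (D : ℝ) ^ (τ / (d - 1)) ≤ ((d : ℝ) ^ d * (a : ℝ) ^ (d - 1)) ^ (τ / (d - 1)) :=
        Real.rpow_le_rpow (by positivity) h1 (div_nonneg hτ (by linarith))
    _ = _ := by
        rw [Real.mul_rpow (by positivity) (by positivity), ← Real.rpow_natCast (a : ℝ) (d - 1),
          ← Real.rpow_mul (by positivity), Nat.cast_sub (by lia), Nat.cast_one,
          mul_div_cancel₀ _ (by linarith : (d : ℝ) - 1 ≠ 0)]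

theorem exponent_le {d ℓ : ℕ} (hd : 3 ≤ d) (hℓ : 0 < ℓ) {δ ε : ℝ} (hδ : 0 < δ)
    (hδε : 2 * δ ≤ ε) :
    (1 + δ) / 2 - ((1 - 1 / d) / ℓ * (1 - δ) - δ) / ((d : ℝ) - 1) ≤
      (1 : ℝ) / 2 - 1 / (2 * ((d : ℝ) - 1) * (ℓ : ℝ)) - 1 / (2 * (d : ℝ) * ((d : ℝ) - 1) * (ℓ : ℝ))
        + ε := by
  have hd' : (3 : ℝ) ≤ d := by exact_mod_cast hd
  have hℓ' : (1 : ℝ) ≤ ℓ := by exact_mod_cast hℓ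
  have hd1 : (0 : ℝ) < d - 1 := by linarith
  have h1 : ((1 - 1 / d) / ℓ * (1 - δ) - δ) / ((d : ℝ) - 1) =
      1 / (d * ℓ) - δ * (1 / (d * ℓ)) - δ * (1 / (d - 1)) := by
    field_simp
  have h2 : 1 / (d * ℓ : ℝ) - 1 / (2 * ((d : ℝ) - 1) * (ℓ : ℝ)) -
      1 / (2 * (d : ℝ) * ((d : ℝ) - 1) * (ℓ : ℝ)) = (d - 3) / (2 * d * (d - 1) * ℓ) := by
    field_simp
    ring
  have h3 : (0 : ℝ) ≤ (d - 3) / (2 * d * (d - 1) * ℓ) :=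
    div_nonneg (by linarith) (by positivity)
  have h4 : 1 / (d * ℓ : ℝ) ≤ 1 / 2 := one_div_le_one_div_of_le two_pos (by nlinarith)
  have h5 : 1 / ((d : ℝ) - 1) ≤ 1 / 2 := one_div_le_one_div_of_le two_pos (by linarith)
  rw [h1]
  nlinarith

theorem exponent_pos {d ℓ : ℕ} (hd : 3 ≤ d) (hℓ : 0 < ℓ) :
    0 ≤ (1 : ℝ) / 2 - 1 / (2 * ((d : ℝ) - 1) * (ℓ : ℝ)) -
      1 / (2 * (d : ℝ) * ((d : ℝ) - 1) * (ℓ : ℝ)) := by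
  have hd' : (3 : ℝ) ≤ d := by exact_mod_cast hd
  have hℓ' : (1 : ℝ) ≤ ℓ := by exact_mod_cast hℓ
  have h1 : 1 / (2 * ((d : ℝ) - 1) * (ℓ : ℝ)) ≤ 1 / 4 :=
    one_div_le_one_div_of_le (by norm_num) (by nlinarith)
  have h2 : 1 / (2 * (d : ℝ) * ((d : ℝ) - 1) * (ℓ : ℝ)) ≤ 1 / 4 :=
    one_div_le_one_div_of_le (by norm_num) (by
      have : (4 : ℝ) ≤ 2 * d * (d - 1) := by nlinarith
      nlinarith)
  linarith
end Asymptotics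

theorem exists_eventually_card_torsion_le {d ℓ : ℕ} (hd3 : 3 ≤ d) (hodd : Odd d) (hℓ : 0 < ℓ)
    {ε : ℝ} (hε : 0 < ε) :
    ∃ C : ℝ, ∀ᶠ a : ℕ in Filter.atTop, ∀ (K : Type) (_ : Field K) (_ : NumberField K) (θ : K),
      Squarefree a → θ ^ d = (a : K) → IntermediateField.adjoin ℚ {θ} = ⊤ →
      Module.finrank ℚ K = d →
      (Nat.card {c : ClassGroup (𝓞 K) // c ^ ℓ = 1} : ℝ) ≤
        C * (DK K : ℝ) ^ ((1 : ℝ) / 2 - 1 / (2 * ((d : ℝ) - 1) * (ℓ : ℝ))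
          - 1 / (2 * (d : ℝ) * ((d : ℝ) - 1) * (ℓ : ℝ)) + ε) := by
  have hd2 : 2 ≤ d := by lia
  have hd' : (3 : ℝ) ≤ d := by exact_mod_cast hd3
  have hℓ' : (1 : ℝ) ≤ ℓ := by exact_mod_cast hℓ
  obtain ⟨δ, hδ, hδε, hδℓ⟩ : ∃ δ : ℝ, 0 < δ ∧ 2 * δ ≤ ε ∧ 4 * ℓ * δ ≤ 1 := by
    refine ⟨min (ε / 2) (1 / (4 * ℓ)), by positivity, ?_, ?_⟩
    · linarith [min_le_left (ε / 2) (1 / (4 * ℓ : ℝ))]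
    · calc 4 * ℓ * min (ε / 2) (1 / (4 * ℓ : ℝ)) ≤ 4 * ℓ * (1 / (4 * ℓ)) := by
            gcongr
            exact min_le_right _ _
        _ = 1 := by field_simp
  have hδ1 : δ < 1 := by nlinarith
  set κ : ℝ := (1 - 1 / d) / ℓ * (1 - δ) with hκ
  have hτ : 0 ≤ κ - δ := by
    have h1 : 1 / (d : ℝ) ≤ 1 / 3 := one_div_le_one_div_of_le (by norm_num) hd'
    have h2 : ℓ * κ = (1 - 1 / d) * (1 - δ) := by rw [hκ]; field_simp
    have h3 : ℓ * δ ≤ ℓ * κ := by nlinarith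
    linarith [le_of_mul_le_mul_left h3 (by linarith)]
  obtain ⟨c, hc, hcard⟩ := exists_eventually_le_card_primes hd2 hodd hℓ hδ hδ1
  set M : ℝ := 2 * 2 ^ d with hM
  set Z : ℝ := ∑' n : ℕ, 1 / (n : ℝ) ^ (1 + δ) with hZ
  have hZ0 : 0 ≤ Z := tsum_nonneg fun n ↦ by positivity
  have hdd : (1 : ℝ) ≤ (d : ℝ) ^ d := one_le_pow₀ (by linarith)
  have hM1 : (1 : ℝ) ≤ M := by
    have : (1 : ℝ) ≤ 2 ^ d := one_le_pow₀ one_le_two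
    linarith
  set W : ℝ := ((d : ℝ) ^ d) ^ ((κ - δ) / (d - 1)) with hW
  refine ⟨M ^ (1 + δ) * Z ^ d / c * W, ?_⟩
  filter_upwards [hcard, eventually_log_pow_le d ℓ (by lia) (by nlinarith : 1 ≤ M * (d : ℝ) ^ d) hδ,
    (tendsto_primeRange hd2 hℓ).eventually_ge_atTop 1, Filter.eventually_ge_atTop 1]
    with a hcard hlog hx ha1 K _ _ θ ha hθ htop hfr
  have ha0 : (1 : ℝ) ≤ a := by exact_mod_cast ha1
  have hD : DK K ≤ _ := natAbs_discr_le_of_pow ha hθ htop hfr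
  have key := card_torsion_mul_card_primes_le hodd hℓ ha hθ htop hfr hx
    (mul_primeRange_pow_lt (by lia) hℓ ha1) (by linarith : 1 < 1 + δ)
  set N : ℝ := (Nat.card {c : ClassGroup (𝓞 K) // c ^ ℓ = 1} : ℝ) with hN
  have hDK : |(discr K : ℝ)| = (DK K : ℝ) := by
    rw [DK, ← Int.cast_abs, Int.abs_eq_natAbs, Int.cast_natCast]
  have hD1 : (1 : ℝ) ≤ DK K := by
    rw [← hDK]
    exact_mod_cast Int.one_le_abs (discr_ne_zero K)
  rw [hDK, ← mul_assoc, ← hM] at key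
  have hsq : √(DK K : ℝ) ≤ (d : ℝ) ^ d * (a : ℝ) ^ d := by
    refine (Real.sqrt_le_left (by positivity)).mpr ?_
    have h1 : (DK K : ℝ) ≤ (d : ℝ) ^ d * (a : ℝ) ^ (d - 1) := by exact_mod_cast hD
    have h2 : (a : ℝ) ^ (d - 1) ≤ (a : ℝ) ^ d := pow_le_pow_right₀ ha0 (by lia)
    have h3 : (1 : ℝ) ≤ (d : ℝ) ^ d * (a : ℝ) ^ d := by
      have := one_le_pow₀ (n := d) ha0
      nlinarith
    nlinarith
  have hsq1 : 1 ≤ √(DK K : ℝ) := Real.one_le_sqrt.mpr hD1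
  have hxd1 : 1 ≤ primeRange d ℓ a ^ d := one_le_pow₀ hx
  have hxd : primeRange d ℓ a ^ d ≤ (a : ℝ) ^ d :=
    pow_le_pow_left₀ (by linarith) (primeRange_le (by lia) hℓ ha1) d
  have h1 : 1 ≤ M * √(DK K : ℝ) * primeRange d ℓ a ^ d :=
    one_le_mul_of_one_le_of_one_le (one_le_mul_of_one_le_of_one_le hM1 hsq1) hxd1
  have h2 : M * √(DK K : ℝ) * primeRange d ℓ a ^ d ≤ M * (d : ℝ) ^ d * (a : ℝ) ^ (2 * d) := by
    calc _ ≤ M * ((d : ℝ) ^ d * (a : ℝ) ^ d) * (a : ℝ) ^ d := by gcongr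
      _ = _ := by ring
  have hlog' : (2 * (ℓ * Real.log (M * √(DK K : ℝ) * primeRange d ℓ a ^ d)) + 2) ^ d ≤
      (a : ℝ) ^ δ := by
    refine le_trans ?_ hlog
    have := Real.log_nonneg h1
    gcongr
  have h3 : N * (c * (a : ℝ) ^ κ) ≤ M ^ (1 + δ) * (DK K : ℝ) ^ ((1 + δ) / 2) * Z ^ d * a ^ δ := by
    refine (mul_le_mul_of_nonneg_left hcard (Nat.cast_nonneg _)).trans (key.trans ?_)
    have h4 : (M * √(DK K : ℝ)) ^ (1 + δ) = M ^ (1 + δ) * (DK K : ℝ) ^ ((1 + δ) / 2) := by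
      rw [Real.mul_rpow (by positivity) (by positivity), Real.sqrt_eq_rpow,
        ← Real.rpow_mul (by positivity), one_div_mul_eq_div]
    rw [h4]
    gcongr
  have h5 := rpow_le_of_le_mul_pow hd2 hD hτ
  set E := (1 : ℝ) / 2 - 1 / (2 * ((d : ℝ) - 1) * (ℓ : ℝ))
    - 1 / (2 * (d : ℝ) * ((d : ℝ) - 1) * (ℓ : ℝ)) + ε with hE
  have h6 : (DK K : ℝ) ^ ((1 + δ) / 2) ≤
      (DK K : ℝ) ^ E * (DK K : ℝ) ^ ((κ - δ) / (d - 1)) := by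
    rw [← Real.rpow_add (by linarith)]
    refine Real.rpow_le_rpow_of_exponent_le hD1 ?_
    linarith [exponent_le hd3 hℓ hδ hδε]
  have h7 : (a : ℝ) ^ κ = (a : ℝ) ^ (κ - δ) * (a : ℝ) ^ δ := by
    rw [← Real.rpow_add (by linarith), sub_add_cancel]
  have hκ0 : 0 < c * (a : ℝ) ^ κ := by positivity
  refine le_of_mul_le_mul_right (h3.trans ?_) hκ0
  calc M ^ (1 + δ) * (DK K : ℝ) ^ ((1 + δ) / 2) * Z ^ d * a ^ δ
      ≤ M ^ (1 + δ) * ((DK K : ℝ) ^ E * (W * (a : ℝ) ^ (κ - δ))) * Z ^ d * a ^ δ := by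
        have := h6.trans (mul_le_mul_of_nonneg_left h5 (by positivity))
        gcongr
    _ = M ^ (1 + δ) * Z ^ d / c * W * (DK K : ℝ) ^ E * (c * (a : ℝ) ^ κ) := by
        rw [h7]
        field_simp

/-- torsion bound for pure fields of odd degree `d` with `a` squarefree. -/
theorem torsion_pure_field_squarefree (d ℓ : ℕ) (hd3 : 3 ≤ d) (hodd : Odd d) (hℓ : 0 < ℓ)
    (ε : ℝ) (hε : 0 < ε) :
    ∃ C : ℝ, 0 < C ∧
      ∀ (K : Type) (_ : Field K) (_ : NumberField K) (a : ℕ) (θ : K),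
        Squarefree a → 1 < a →
        Irreducible ((Polynomial.X : ℚ[X]) ^ d - Polynomial.C (a : ℚ)) →
        θ ^ d = (a : K) → IntermediateField.adjoin ℚ {θ} = ⊤ →
        Module.finrank ℚ K = d →
        (Nat.card {c : ClassGroup (𝓞 K) // c ^ ℓ = 1} : ℝ) ≤
          C * (DK K : ℝ) ^ ((1 : ℝ) / 2 - 1 / (2 * ((d : ℝ) - 1) * (ℓ : ℝ))
              - 1 / (2 * (d : ℝ) * ((d : ℝ) - 1) * (ℓ : ℝ)) + ε) := by
  obtain ⟨C₁, h⟩ := exists_eventually_card_torsion_le hd3 hodd hℓ hε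
  obtain ⟨a₀, h⟩ := Filter.eventually_atTop.mp h
  obtain ⟨C₂, hC₂⟩ : ∃ C₂ : ℝ, ∀ (K : Type) (_ : Field K) (_ : NumberField K),
      Module.finrank ℚ K = d → (discr K).natAbs ≤ d ^ d * a₀ ^ (d - 1) →
      (Nat.card {c : ClassGroup (𝓞 K) // c ^ ℓ = 1} : ℝ) ≤ C₂ :=
    ⟨_, fun K _ _ hfr hD ↦ by simpa only [hfr] using card_torsion_le_of_discr_le hℓ hD⟩
  refine ⟨max C₁ (max C₂ 1), by positivity, fun K _ _ a θ ha ha1 _ hθ htop hfr ↦ ?_⟩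
  have hD1 : (1 : ℝ) ≤ DK K := by
    exact_mod_cast Int.natAbs_pos.mpr (discr_ne_zero K)
  rcases le_total a₀ a with haa | haa
  · refine (h a haa K inferInstance inferInstance θ ha hθ htop hfr).trans ?_
    gcongr
    exact le_max_left _ _
  · have hD : (discr K).natAbs ≤ d ^ d * a₀ ^ (d - 1) :=
      (natAbs_discr_le_of_pow ha hθ htop hfr).trans (by gcongr)
    have hE := exponent_pos hd3 hℓ
    calc _ ≤ C₂ := hC₂ K inferInstance inferInstance hfr hD
      _ ≤ max C₁ (max C₂ 1) := (le_max_left _ _).trans (le_max_right _ _)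
      _ ≤ _ := le_mul_of_one_le_right (by positivity) (Real.one_le_rpow hD1 (by linarith))
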